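/- arXiv:1703.08203 — 3 statements merged into one kernel-verified Lean document; each statement's English description precedes it below -/
import Mathlib

section
/- The ring of algebraic power series K[[X]]_alg over a field K is isomorphic, as a local K[X]_{(X)}-algebra, to the henselization of the localization K[X]_{(X₁,…,Xₙ)} of the polynomial ring at the maximal ideal generated by the variables. -/
/-- A multivariate power series is algebraic if it satisfies a nonzero polynomial
relation over `K[X₁,…,Xₙ]`. -/
def IsAlgebraicMvPowerSeries {K : Type*} [CommRing K] {n : ℕ}
    (φ : MvPowerSeries (Fin n) K) : Prop :=
  ∃ q : Polynomial (MvPolynomial (Fin n) K), q ≠ 0 ∧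
    Polynomial.eval₂ MvPolynomial.coeToMvPowerSeries.ringHom φ q = 0



section HClosedSec
open Polynomial

lemma subring_algebraMap {O : Type*} [CommRing O] (H : Subring O) (x : H) :
    algebraMap H O x = x := rfl

/-- `H` contains `P`, is closed under inverses and under simple roots of monic polynomials. -/
structure HClosed {O : Type*} [CommRing O] (P H : Subring O) : Prop where
  le : P ≤ H
  inv : ∀ x ∈ H, ∀ y, x * y = 1 → y ∈ H
  root : ∀ (f : Polynomial H) (t : O), f.Monic → aeval t f = 0 →
    IsUnit (aeval t (derivative f)) → t ∈ H

lemma HClosed.nonmonic {O : Type*} [CommRing O] [IsLocalRing O] {P H : Subring O}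
    (hH : HClosed P H) (e u : H) (g : Polynomial H) (y : O) (hy : ¬ IsUnit y)
    (hu : IsUnit (u : O)) (h : (e : O) + u * y + y ^ 2 * aeval y g = 0) : y ∈ H := by
  obtain ⟨v', hv'⟩ := hu.exists_right_inv
  have hv'H := hH.inv _ u.2 _ hv'
  obtain ⟨v, rfl⟩ : ∃ v : H, (v : O) = v' := ⟨⟨v', hv'H⟩, rfl⟩
  set w : O := -(1 + v * y * aeval y g) with hw
  set ε : H := e * v with hε
  have hyw : y * w = (ε : O) := by
    have : (ε : O) = e * v := rfl
    rw [this, hw]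
    linear_combination (-(v : O)) * h + y * hv'
  set N := g.natDegree + 1 with hN
  set G : Polynomial H := ∑ k ∈ Finset.range N, C (v * g.coeff k * ε ^ k) * X ^ (N - 1 - k) with hG
  set F : Polynomial H := X ^ N * (X + C 1) + C ε * G with hF
  have hym : y ∈ IsLocalRing.maximalIdeal O := hy
  have hεm : (ε : O) ∈ IsLocalRing.maximalIdeal O := by
    rw [← hyw]; exact Ideal.mul_mem_right _ _ hym
  have hw1 : w + 1 ∈ IsLocalRing.maximalIdeal O := by
    have : w + 1 = - (v * aeval y g) * y := by rw [hw]; ring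
    rw [this]; exact Ideal.mul_mem_left _ _ hym
  have hwu : IsUnit w := by
    by_contra hc
    have h2 : w ∈ IsLocalRing.maximalIdeal O := hc
    have : (1 : O) ∈ IsLocalRing.maximalIdeal O := by
      have := Ideal.sub_mem _ hw1 h2
      simpa using this
    exact (IsLocalRing.maximalIdeal.isMaximal O).ne_top ((Ideal.eq_top_iff_one _).2 this)
  have hm : F.Monic := by
    have h1 : (X ^ N * (X + C 1) : Polynomial H).Monic := (monic_X_pow N).mul (monic_X_add_C 1)
    apply h1.add_of_left
    have h2 : (X ^ N * (X + C 1) : Polynomial H).degree = ((N + 1 : ℕ) : WithBot ℕ) := by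
      rw [(monic_X_add_C 1).degree_mul, degree_X_pow, degree_X_add_C]; rfl
    rw [h2]
    have h3 : (C ε * G).degree ≤ ((N - 1 : ℕ) : WithBot ℕ) := by
      rw [hG, Finset.mul_sum]
      refine (degree_sum_le _ _).trans (Finset.sup_le fun k _ => ?_)
      rw [← mul_assoc, ← C_mul]
      refine (degree_C_mul_X_pow_le _ _).trans ?_
      exact_mod_cast Nat.sub_le _ _
    refine h3.trans_lt ?_
    exact_mod_cast (by omega)
  have hroot : aeval w F = 0 := by
    have h1 : (ε : O) * aeval w G = w ^ N * (v * y * aeval y g) := by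
      rw [hG, map_sum, Finset.mul_sum, aeval_eq_sum_range, Finset.mul_sum, Finset.mul_sum]
      refine Finset.sum_congr rfl fun k hk => ?_
      have hk' : k < N := Finset.mem_range.1 hk
      simp only [map_mul, aeval_C, map_pow, aeval_X, subring_algebraMap, Algebra.smul_def]
      change (ε : O) * ((v : O) * (g.coeff k : O) * (ε : O) ^ k * w ^ (N - 1 - k)) = _
      rw [← hyw]
      have : N = (k + 1) + (N - 1 - k) := by omega
      generalize N - 1 - k = M at *
      rw [this]
      ring
    simp only [hF, map_add, map_mul, map_pow, aeval_X, aeval_C, subring_algebraMap, map_one]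
    rw [h1, hw]
    push_cast
    ring
  have hder : IsUnit (aeval w (derivative F)) := by
    have h1 : aeval w (derivative F) = w ^ N +
        ((N * w ^ (N - 1)) * (w + 1) + (aeval w (derivative G)) * ε) := by
      simp only [hF, derivative_add, derivative_mul, derivative_X_pow, derivative_C, derivative_X,
        map_add, map_mul, map_pow, aeval_X, aeval_C, subring_algebraMap, map_one, map_natCast,
        map_zero, derivative_one, zero_mul]
      change _ + _ + (0 + (ε : O) * _) = _
      ring
    rw [h1]
    by_contra hc
    have hc' : _ ∈ IsLocalRing.maximalIdeal O := hc
    have h3 : ((N * w ^ (N - 1)) * (w + 1) + (aeval w (derivative G)) * ε) ∈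
      IsLocalRing.maximalIdeal O := Ideal.add_mem _ (Ideal.mul_mem_left _ _ hw1)
        (Ideal.mul_mem_left _ _ hεm)
    have h4 := (Ideal.add_mem_iff_left _ h3).1 hc'
    exact h4 (hwu.pow N)
  have hwH := hH.root F w hm hroot hder
  obtain ⟨z, hz⟩ := hwu.exists_right_inv
  have hzH := hH.inv _ hwH _ hz
  have : y = ε * z := by rw [← hyw, mul_assoc, hz, mul_one]
  rw [this]
  exact H.mul_mem ε.2 hzH

end HClosedSec


section AlgHelpers
open Polynomial

lemma isAlgebraic_of_root {R E : Type*} [CommRing R] [IsDomain R] [CommRing E] [IsDomain E]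
    [Algebra R E] (f : E[X]) (hf : f ≠ 0) (hc : ∀ i, IsAlgebraic R (f.coeff i)) (x : E)
    (hx : f.eval x = 0) : IsAlgebraic R x := by
  set L := Subalgebra.algebraicClosure R E
  have hL : Algebra.IsAlgebraic R L := by
    constructor
    intro y
    have h1 : IsAlgebraic R (algebraMap L E y) := y.2
    exact (isAlgebraic_algebraMap_iff (FaithfulSMul.algebraMap_injective L E)).1 h1
  apply IsAlgebraic.restrictScalars R (S := L)
  obtain ⟨g, hg⟩ : f ∈ lifts (algebraMap L E) := by
    rw [lifts_iff_coeff_lifts]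
    intro n
    exact ⟨⟨f.coeff n, hc n⟩, rfl⟩
  refine ⟨g, ?_, ?_⟩
  · rintro rfl; apply hf; rw [← hg]; simp
  · rw [aeval_def, ← eval_map]
    rw [coe_mapRingHom] at hg
    rw [hg, hx]

/-- The subfield of elements algebraic over `R`. -/
def algSubfield (R E : Type*) [CommRing R] [IsDomain R] [Field E] [Algebra R E] : Subfield E :=
  { (Subalgebra.algebraicClosure R E).toSubring with
    inv_mem' := fun _ hx => IsAlgebraic.inv hx }

lemma mem_algSubfield {R E : Type*} [CommRing R] [IsDomain R] [Field E] [Algebra R E] {x : E} :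
    x ∈ algSubfield R E ↔ IsAlgebraic R x := Iff.rfl

lemma lifts_C {E : Type*} [Field E] (L : Subfield E) {a : E} (ha : a ∈ L) :
    (C a : E[X]) ∈ lifts L.subtype := C_mem_lifts L.subtype ⟨a, ha⟩

lemma lifts_X_sub_C {E : Type*} [Field E] (L : Subfield E) {a : E} (ha : a ∈ L) :
    (X - C a : E[X]) ∈ lifts L.subtype := by
  rw [sub_eq_add_neg, ← C_neg]
  exact Subsemiring.add_mem _ (X_mem_lifts _) (lifts_C L (L.neg_mem ha))

lemma coeff_mem_of_lifts {E : Type*} [Field E] (L : Subfield E) {f : E[X]}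
    (hf : f ∈ lifts L.subtype) (i : ℕ) : f.coeff i ∈ L := by
  rw [lifts_iff_coeff_lifts] at hf
  obtain ⟨y, hy⟩ := hf i
  rw [← hy]; exact y.2

lemma coeff_mem_of_roots {E : Type*} [Field E] [IsAlgClosed E] (L : Subfield E) {f : E[X]}
    (hf : f.Monic) (h : ∀ x, f.eval x = 0 → x ∈ L) (i : ℕ) : f.coeff i ∈ L := by
  apply coeff_mem_of_lifts
  rw [(IsAlgClosed.splits f).eq_prod_roots_of_monic hf]
  apply multiset_prod_mem
  intro g hg
  obtain ⟨a, ha, rfl⟩ := Multiset.mem_map.1 hg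
  exact lifts_X_sub_C L (h a (isRoot_of_mem_roots ha))

lemma coeff_mem_of_interp {E : Type*} [Field E] (L : Subfield E) (s : Finset E)
    (hs : ∀ x ∈ s, x ∈ L) (r : E[X]) (hr : r.degree < s.card) (hv : ∀ x ∈ s, r.eval x ∈ L)
    (i : ℕ) : r.coeff i ∈ L := by
  classical
  apply coeff_mem_of_lifts
  rw [Lagrange.eq_interpolate (f := r) (s := s) (v := id) Function.injective_id.injOn hr,
    Lagrange.interpolate_apply]
  apply sum_mem
  intro x hx
  apply Subsemiring.mul_mem
  · exact lifts_C L (hv x hx)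
  · apply prod_mem
    intro y hy
    rw [Lagrange.basisDivisor]
    apply Subsemiring.mul_mem
    · exact lifts_C L (L.inv_mem (L.sub_mem (hs x hx) (hs y (Finset.mem_of_mem_erase hy))))
    · exact lifts_X_sub_C L (hs y (Finset.mem_of_mem_erase hy))

end AlgHelpers

section Weier
open Polynomial PowerSeries IsLocalRing

variable {A : Type*} [CommRing A] [IsLocalRing A]

lemma distinguished_order {V : A[X]} (hV : V.IsDistinguishedAt (maximalIdeal A)) :
    ((V : A⟦X⟧).map (Ideal.Quotient.mk (maximalIdeal A))).order.toNat = V.natDegree := by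
  have := hV.coe_natDegree_eq_order_map (V : A⟦X⟧) 1 (by simp) (by simp)
  rw [← this]; rfl

lemma wd_exists [IsAdicComplete (maximalIdeal A) A] {V : A[X]}
    (hV : V.IsDistinguishedAt (maximalIdeal A)) (φ : A⟦X⟧) :
    ∃ (s : A⟦X⟧) (r : A[X]), φ = V * s + r ∧ r.degree < V.natDegree := by
  have h := hV.isWeierstrassDivisorAt' |>.isWeierstrassDivisionAt_div_mod φ
  refine ⟨_, _, h.2, ?_⟩
  have := h.1
  rwa [distinguished_order hV] at this

lemma wd_unique [IsAdicComplete (maximalIdeal A) A] {V : A[X]}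
    (hV : V.IsDistinguishedAt (maximalIdeal A)) {s s' : A⟦X⟧} {r r' : A[X]}
    (hr : r.degree < V.natDegree) (hr' : r'.degree < V.natDegree)
    (h : V * s + (r : A⟦X⟧) = V * s' + (r' : A⟦X⟧)) : s = s' ∧ r = r' := by
  refine hV.isWeierstrassDivisorAt'.eq_of_mul_add_eq_mul_add ?_ ?_ h <;>
  rwa [distinguished_order hV]

lemma wd_poly [IsAdicComplete (maximalIdeal A) A] {V : A[X]}
    (hV : V.IsDistinguishedAt (maximalIdeal A)) {s : A⟦X⟧} {f : A[X]}
    (h : (f : A⟦X⟧) = V * s) : s = ((f /ₘ V : A[X]) : A⟦X⟧) ∧ f = V * (f /ₘ V) := by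
  have h1 := modByMonic_add_div f V
  have h2 : V * s + ((0 : A[X]) : A⟦X⟧) = V * ((f /ₘ V : A[X]) : A⟦X⟧) + ((f %ₘ V : A[X]) : A⟦X⟧) := by
    rw [Polynomial.coe_zero, add_zero, ← h, ← Polynomial.coe_mul, ← Polynomial.coe_add, add_comm, h1]
  have h3 := wd_unique hV (by rw [degree_zero]; exact WithBot.bot_lt_coe _) (by
    rw [← degree_eq_natDegree hV.monic.ne_zero]
    exact degree_modByMonic_lt _ hV.monic) h2
  refine ⟨h3.1, ?_⟩
  rw [← h3.2, zero_add] at h1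
  exact h1.symm

end Weier


section Rem
set_option linter.unusedSectionVars false
open Polynomial PowerSeries IsLocalRing

lemma constCoeff_algebraMap {S : Type*} [CommRing S] (P : Subring S) (p : P[X]) :
    PowerSeries.constantCoeff (algebraMap P[X] S⟦X⟧ p) = (p.coeff 0 : P) := by
  rw [PowerSeries.algebraMap_apply', ← PowerSeries.coeff_zero_eq_constantCoeff_apply,
    PowerSeries.coeff_map, Polynomial.coeff_coe]
  rfl

lemma alg_specialize {S : Type*} [CommRing S] [IsDomain S] (P : Subring S) (c : S⟦X⟧)
    (hc : IsAlgebraic P[X] c) : IsAlgebraic P (PowerSeries.constantCoeff c) := by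
  obtain ⟨q, hq0, hq⟩ := hc
  obtain ⟨i, hi⟩ : ∃ i, q.coeff i ≠ 0 := by
    by_contra! h
    exact hq0 (Polynomial.ext (by simpa using h))
  clear hq0
  induction hd : (q.coeff i).natDegree using Nat.strong_induction_on generalizing q with
  | _ d ih =>
    by_cases h0 : q.map (Polynomial.constantCoeff) = 0
    · have hdv : Polynomial.C (Polynomial.X : P[X]) ∣ q := by
        rw [C_dvd_iff_dvd_coeff]
        intro j
        rw [Polynomial.X_dvd_iff]
        have := congrArg (fun f => Polynomial.coeff f j) h0
        simpa using this
      obtain ⟨q', rfl⟩ := hdv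
      rw [Polynomial.coeff_C_mul] at hi hd
      have hi' : q'.coeff i ≠ 0 := right_ne_zero_of_mul hi
      rw [Polynomial.natDegree_X_mul hi'] at hd
      refine ih _ (by omega) q' ?_ hi' rfl
      rw [map_mul, aeval_C, PowerSeries.algebraMap_apply'] at hq
      have hX : PowerSeries.map (algebraMap P S) ((Polynomial.X : P[X]) : P⟦X⟧) ≠ 0 := by
        rw [Polynomial.coe_X, PowerSeries.map_X]; exact PowerSeries.X_ne_zero
      exact (mul_eq_zero.1 hq).resolve_left hX
    · refine ⟨_, h0, ?_⟩
      have := congrArg (PowerSeries.constantCoeff) hq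
      rw [aeval_def, Polynomial.hom_eval₂, map_zero] at this
      rw [aeval_def, Polynomial.eval₂_map, ← this]
      congr 1

variable {S : Type*} [CommRing S] [IsDomain S] [IsLocalRing S]

/-- the deformation of `V` -/
noncomputable def defV (V : S[X]) : (S⟦X⟧)[X] :=
  V.map (PowerSeries.C) + Polynomial.C (PowerSeries.X) * (1 + Polynomial.X)

lemma defV_monic {V : S[X]} (hV : V.Monic) (hm : 2 ≤ V.natDegree) :
    (defV V).Monic ∧ (defV V).natDegree = V.natDegree := by
  have h1 : (V.map (PowerSeries.C (R := S))).Monic := hV.map _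
  have h2 : (Polynomial.C (PowerSeries.X : S⟦X⟧) * (1 + Polynomial.X)).degree <
      (V.map (PowerSeries.C (R := S))).degree := by
    rw [degree_eq_natDegree h1.ne_zero, hV.natDegree_map]
    have : (Polynomial.C (PowerSeries.X : S⟦X⟧) * (1 + Polynomial.X)).degree ≤ ((1 : ℕ) : WithBot ℕ) := by
      compute_degree
      exact le_rfl
    refine this.trans_lt ?_
    exact_mod_cast (by omega)
  refine ⟨h1.add_of_left h2, ?_⟩
  rw [defV, natDegree_add_eq_left_of_degree_lt h2, hV.natDegree_map]

lemma defV_dist {V : S[X]} (hV : V.IsDistinguishedAt (maximalIdeal S)) (hm : 2 ≤ V.natDegree) :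
    (defV V).IsDistinguishedAt (maximalIdeal S⟦X⟧) := by
  obtain ⟨h1, h2⟩ := defV_monic hV.monic hm
  refine ⟨⟨fun {n} hn => ?_⟩, h1⟩
  rw [h2] at hn
  have h3 := hV.mem hn
  rw [mem_maximalIdeal, mem_nonunits_iff, PowerSeries.isUnit_iff_constantCoeff]
  simp only [defV, Polynomial.coeff_add, Polynomial.coeff_map, Polynomial.coeff_C_mul, map_add,
    map_mul, PowerSeries.constantCoeff_X, zero_mul, add_zero, PowerSeries.constantCoeff_C]
  exact h3

lemma defV_map {V : S[X]} : (defV V).map (PowerSeries.constantCoeff) = V := by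
  simp only [defV, Polynomial.map_add, Polynomial.map_mul, Polynomial.map_C, 
    PowerSeries.constantCoeff_X, map_zero, zero_mul, add_zero, Polynomial.map_map]
  convert Polynomial.map_id
  ext; simp

lemma dist_eval_neg_one {V : S[X]} (hV : V.IsDistinguishedAt (maximalIdeal S)) :
    V.eval (-1) ≠ 0 := by
  intro h
  have h1 := hV.map_eq_X_pow
  have h2 := congrArg (Ideal.Quotient.mk (maximalIdeal S)) h
  rw [← Polynomial.eval_map_apply, h1] at h2
  simp at h2

lemma aeval_X_coe (p : S[X]) : aeval (PowerSeries.X : S⟦X⟧) p = (p : S⟦X⟧) := by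
  induction p using Polynomial.induction_on' with
  | add p q hp hq => rw [map_add, hp, hq, Polynomial.coe_add]
  | monomial n a =>
    rw [aeval_monomial, Polynomial.coe_monomial, PowerSeries.algebraMap_apply,
      Algebra.algebraMap_self, RingHom.id_apply, PowerSeries.X_pow_eq,
      ← PowerSeries.monomial_zero_eq_C_apply, PowerSeries.monomial_mul_monomial]
    simp

lemma transc_X : Transcendental S (PowerSeries.X : S⟦X⟧) := by
  rw [transcendental_iff]
  intro p hp
  rw [aeval_X_coe] at hp
  exact Polynomial.coe_injective S (by simpa using hp)

section
variable {E : Type*} [Field E] [Algebra S⟦X⟧ E] [Algebra S E] [IsScalarTower S S⟦X⟧ E]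
  [FaithfulSMul S⟦X⟧ E]

lemma defV_eval (V : S[X]) (x : E) : aeval x (defV V) =
    aeval x V + algebraMap S⟦X⟧ E PowerSeries.X * (1 + x) := by
  rw [defV, map_add]
  congr 1
  · rw [aeval_def, Polynomial.eval₂_map, aeval_def]
    congr 1
    exact (IsScalarTower.algebraMap_eq S S⟦X⟧ E).symm
  · simp

lemma defV_root_transc {V : S[X]} (hV : V.IsDistinguishedAt (maximalIdeal S)) (x : E)
    (hx : aeval x (defV V) = 0) : Transcendental S x := by
  intro halg
  rw [defV_eval] at hx
  have hinj : Function.Injective (algebraMap S⟦X⟧ E) := FaithfulSMul.algebraMap_injective _ _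
  have hinjS : Function.Injective (algebraMap S E) := by
    rw [IsScalarTower.algebraMap_eq S S⟦X⟧ E]
    exact hinj.comp PowerSeries.C_injective
  have hx1 : 1 + x ≠ 0 := by
    intro h
    have : x = algebraMap S E (-1) := by rw [map_neg, map_one]; linear_combination h
    rw [h, mul_zero, add_zero, this, Polynomial.aeval_algebraMap_apply] at hx
    apply dist_eval_neg_one hV
    apply hinjS
    rw [map_zero, ← hx]; simp
  have h1 : algebraMap S⟦X⟧ E PowerSeries.X = - aeval x V * (1 + x)⁻¹ := by
    field_simp
    linear_combination hx
  have h2 : IsAlgebraic S (algebraMap S⟦X⟧ E PowerSeries.X) := by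
    rw [h1]
    have h3 : aeval x V ∈ Subalgebra.algebraicClosure S E := by
      have := (aeval (⟨x, halg⟩ : Subalgebra.algebraicClosure S E) V).2
      rwa [← Subalgebra.aeval_coe] at this
    exact (IsAlgebraic.neg h3).mul (isAlgebraic_one.add halg).inv
  rw [isAlgebraic_algebraMap_iff hinj] at h2
  exact transc_X h2

lemma defV_root_simple {V : S[X]} (hV : V.IsDistinguishedAt (maximalIdeal S)) (x : E)
    (hx : aeval x (defV V) = 0) : aeval x (derivative (defV V)) ≠ 0 := by
  intro h
  have ht := defV_root_transc hV x hx
  have h1 : aeval x (derivative (defV V)) = aeval x (derivative V) +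
      algebraMap S⟦X⟧ E PowerSeries.X := by
    rw [defV, derivative_add, map_add, derivative_map]
    congr 1
    · rw [aeval_def, Polynomial.eval₂_map, aeval_def]
      congr 1
      exact (IsScalarTower.algebraMap_eq S S⟦X⟧ E).symm
    · simp
  rw [h1] at h
  rw [defV_eval] at hx
  have h2 : aeval x (V - (1 + Polynomial.X) * derivative V) = 0 := by
    simp only [map_sub, map_mul, map_add, map_one, aeval_X]
    linear_combination hx - (1 + x) * h
  have h3 := (transcendental_iff.1 ht) _ h2
  apply dist_eval_neg_one hV
  have := congrArg (Polynomial.eval (-1)) h3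
  simpa using this
end

end Rem


section Rem2
set_option linter.unusedSectionVars false
open Polynomial PowerSeries IsLocalRing

variable {S : Type*} [CommRing S] [IsDomain S] [IsLocalRing S]

lemma alg_C (P : Subring S) {a : S} (ha : IsAlgebraic P a) :
    IsAlgebraic P[X] (PowerSeries.C a : S⟦X⟧) := by
  have h1 : IsAlgebraic P (algebraMap S S⟦X⟧ a) := ha.algebraMap
  exact h1.extendScalars (S := P[X]) Polynomial.C_injective

lemma alg_X (P : Subring S) :
    IsAlgebraic P[X] (PowerSeries.X : S⟦X⟧) := by
  have : (PowerSeries.X : S⟦X⟧) = algebraMap P[X] S⟦X⟧ Polynomial.X := by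
    rw [PowerSeries.algebraMap_apply', Polynomial.coe_X, PowerSeries.map_X]
  rw [this]; exact isAlgebraic_algebraMap _

lemma defV_coeff_alg (P : Subring S) {V : S[X]} (hVa : ∀ i, IsAlgebraic P (V.coeff i)) (i : ℕ) :
    IsAlgebraic P[X] ((defV V).coeff i) := by
  simp only [defV, Polynomial.coeff_add, Polynomial.coeff_map, Polynomial.coeff_C_mul]
  refine (alg_C P (hVa i)).add ((alg_X P).mul ?_)
  simp only [Polynomial.coeff_one, Polynomial.coeff_X]
  refine IsAlgebraic.add ?_ ?_ <;> split_ifs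
  all_goals first | exact isAlgebraic_one | exact isAlgebraic_zero

lemma rem_alg [IsAdicComplete (maximalIdeal S) S]
    [IsAdicComplete (maximalIdeal S⟦X⟧) S⟦X⟧] (P : Subring S) {V : S[X]}
    (hV : V.IsDistinguishedAt (maximalIdeal S)) (hm : 2 ≤ V.natDegree)
    (hVa : ∀ i, IsAlgebraic P (V.coeff i)) (φ s : S⟦X⟧) (r : S[X])
    (hφ : IsAlgebraic P[X] φ) (h : φ = V * s + r) (hr : r.degree < V.natDegree) (i : ℕ) :
    IsAlgebraic P (r.coeff i) := by
  classical
  obtain ⟨q, hq0, hq⟩ := hφ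
  have hV1 := defV_dist hV hm
  obtain ⟨hV1m, hV1d⟩ := defV_monic hV.monic hm
  set V1 := defV V with hV1def
  let ι : P[X] →+* (S⟦X⟧)[X] := mapRingHom ((PowerSeries.C (R := S)).comp (algebraMap P S))
  let φ1 : (S⟦X⟧)⟦X⟧ := PowerSeries.map (PowerSeries.C (R := S)) φ
  obtain ⟨s1, r1, h1, hr1⟩ := wd_exists hV1 φ1
  set co : (S⟦X⟧)[X] →+* (S⟦X⟧)⟦X⟧ := Polynomial.coeToPowerSeries.ringHom with hco
  have hq1 : eval φ1 (q.map (co.comp ι)) = 0 := by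
    have := congrArg (PowerSeries.map (PowerSeries.C (R := S))) hq
    rw [aeval_def, Polynomial.hom_eval₂, map_zero] at this
    rw [← eval₂_eq_eval_map, ← this]
    congr 1
    ext p j : 3
    all_goals simp [co, ι, PowerSeries.algebraMap_apply']
  set F := eval₂ ι r1 q with hF
  have hFco : (F : (S⟦X⟧)⟦X⟧) = eval (r1 : (S⟦X⟧)⟦X⟧) (q.map (co.comp ι)) := by
    rw [← eval₂_eq_eval_map, hF]
    exact Polynomial.hom_eval₂ q ι co r1
  obtain ⟨g, hg⟩ := Polynomial.sub_dvd_eval_sub (r1 : (S⟦X⟧)⟦X⟧) φ1 (q.map (co.comp ι))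
  have hFV : (F : (S⟦X⟧)⟦X⟧) = V1 * (- s1 * g) := by
    rw [hFco]
    rw [hq1, sub_zero] at hg
    rw [hg, h1]; ring
  have hFV2 := (wd_poly hV1 hFV).2
  let E := AlgebraicClosure (FractionRing S⟦X⟧)
  have hinj : Function.Injective (algebraMap S⟦X⟧ E) := by
    rw [IsScalarTower.algebraMap_eq S⟦X⟧ (FractionRing S⟦X⟧) E]
    exact (algebraMap (FractionRing S⟦X⟧) E).injective.comp (IsFractionRing.injective _ _)
  haveI : FaithfulSMul S⟦X⟧ E := (faithfulSMul_iff_algebraMap_injective _ _).2 hinj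
  let L := algSubfield P[X] E
  have hPS : Function.Injective (algebraMap P S) := Subtype.val_injective
  -- roots
  have key : ∀ x : E, aeval x V1 = 0 → x ∈ L ∧ aeval x r1 ∈ L := by
    intro x hx
    have hxt : Transcendental S x := defV_root_transc hV x hx
    have hxa : IsAlgebraic P[X] x := by
      refine isAlgebraic_of_root (V1.map (algebraMap S⟦X⟧ E)) (hV1m.map _).ne_zero ?_ x ?_
      · intro i
        rw [Polynomial.coeff_map]
        exact (defV_coeff_alg P hVa i).algebraMap
      · rw [eval_map_algebraMap, hx]
    refine ⟨hxa, ?_⟩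
    have hxp : Transcendental P x := Transcendental.restrictScalars hPS hxt
    refine isAlgebraic_of_root (R := P[X]) (q.map (aeval (R := P) x).toRingHom) ?_ ?_ _ ?_
    · rw [Ne, Polynomial.map_eq_zero_iff]
      · exact hq0
      · exact transcendental_iff_injective.1 hxp
    · intro i
      rw [Polynomial.coeff_map]
      change IsAlgebraic P[X] (aeval x (q.coeff i))
      rw [aeval_eq_sum_range]
      have : ∑ j ∈ Finset.range ((q.coeff i).natDegree + 1), (q.coeff i).coeff j • x ^ j ∈ L := by
        refine sum_mem fun j _ => ?_
        rw [Algebra.smul_def]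
        refine mul_mem ?_ (pow_mem hxa j)
        rw [IsScalarTower.algebraMap_apply P P[X] E]
        exact isAlgebraic_algebraMap _
      exact this
    · have h2 : aeval x F = 0 := by rw [hFV2, map_mul, hx, zero_mul]
      rw [← eval₂_eq_eval_map, ← h2, hF]
      have h3 := Polynomial.hom_eval₂ q ι (aeval (R := S⟦X⟧) x).toRingHom r1
      refine Eq.trans ?_ h3.symm
      congr 1
      ext : 1
      · ext p
        simp only [ι, RingHom.comp_apply, coe_mapRingHom, Polynomial.map_C, AlgHom.toRingHom_eq_coe,
          RingHom.coe_coe, aeval_C]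
        rw [IsScalarTower.algebraMap_apply P S E, IsScalarTower.algebraMap_apply S S⟦X⟧ E]
        rfl
      · simp [ι]
  set s : Finset E := (V1.map (algebraMap S⟦X⟧ E)).roots.toFinset with hs
  have hmem : ∀ x ∈ s, aeval x V1 = 0 := by
    intro x hx
    rw [hs, Multiset.mem_toFinset] at hx
    have := isRoot_of_mem_roots hx
    rwa [IsRoot.def, eval_map_algebraMap] at this
  have hcard : s.card = V.natDegree := by
    rw [hs, Multiset.toFinset_card_of_nodup, ← (IsAlgClosed.splits _).natDegree_eq_card_roots,
      hV1m.natDegree_map, hV1d]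
    rw [Multiset.nodup_iff_count_le_one]
    intro x
    rw [count_roots]
    by_contra! hc
    rw [one_lt_rootMultiplicity_iff_isRoot (hV1m.map _).ne_zero] at hc
    obtain ⟨ha, hb⟩ := hc
    rw [derivative_map, IsRoot.def, eval_map_algebraMap] at hb
    rw [IsRoot.def, eval_map_algebraMap] at ha
    exact defV_root_simple hV x ha hb
  have hr1a : ∀ i, IsAlgebraic P[X] (r1.coeff i) := by
    intro i
    have := coeff_mem_of_interp L s (fun x hx => (key x (hmem x hx)).1)
      (r1.map (algebraMap S⟦X⟧ E)) (by
        rw [hcard, ← hV1d]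
        exact (degree_map_le).trans_lt hr1) (fun x hx => by
        rw [eval_map_algebraMap]; exact (key x (hmem x hx)).2) i
    rw [Polynomial.coeff_map] at this
    exact (isAlgebraic_algebraMap_iff hinj).1 this
  have hfin : r = r1.map (PowerSeries.constantCoeff) := by
    have h4 := congrArg (PowerSeries.map (PowerSeries.constantCoeff (R := S))) h1
    have h5 : PowerSeries.map (PowerSeries.constantCoeff (R := S)) φ1 = φ := by
      ext j; simp [φ1]
    rw [h5, map_add, map_mul, ← Polynomial.polynomial_map_coe, ← Polynomial.polynomial_map_coe, hV1def, defV_map, h] at h4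
    refine (wd_unique hV hr ?_ h4).2
    rw [← hV1d]
    exact (degree_map_le).trans_lt hr1
  rw [hfin, Polynomial.coeff_map]
  exact alg_specialize P _ (hr1a i)

end Rem2


section KeyStep
set_option linter.unusedSectionVars false
open Polynomial PowerSeries IsLocalRing

/-- every `P`-algebraic element is in each `HClosed` subring. -/
def AlgHens {O : Type*} [CommRing O] (P : Subring O) : Prop :=
  ∀ H, HClosed P H → ∀ φ : O, IsAlgebraic P φ → φ ∈ H

lemma taylor_quad {O : Type*} [CommRing O] (H : Subring O) (q : Polynomial H) (c : H) :
    ∃ G : Polynomial H, ∀ z : O, aeval (c + z : O) q =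
      (eval c q : H) + (eval c (derivative q) : H) * z + z ^ 2 * aeval z G := by
  refine ⟨(taylor c q).divX.divX, fun z => ?_⟩
  have h1 : aeval (c + z : O) q = aeval z (taylor c q) := by
    rw [taylor_apply, aeval_comp]
    congr 2
    simp [subring_algebraMap, add_comm]
  have h2 := divX_mul_X_add (taylor c q)
  have h3 := divX_mul_X_add (taylor c q).divX
  rw [coeff_divX, taylor_coeff_one] at h3
  rw [taylor_coeff_zero] at h2
  rw [h1]
  conv_lhs => rw [← h2, ← h3]
  simp only [map_add, map_mul, aeval_X, aeval_C, subring_algebraMap]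
  ring

lemma HClosed.comap {O O' : Type*} [CommRing O] [CommRing O'] {P : Subring O} {P' H : Subring O'}
    (f : O →+* O') (h : HClosed P' H) (hf : ∀ x ∈ P, f x ∈ P') : HClosed P (H.comap f) := by
  refine ⟨fun x hx => h.le (hf x hx), fun x hx y hxy => ?_, fun g t hg ht hu => ?_⟩
  · exact h.inv _ hx _ (by rw [← map_mul, hxy, map_one])
  · let j : H.comap f →+* H := (f.comp (H.comap f).subtype).codRestrict H (fun x => x.2)
    have key : ∀ p : Polynomial (H.comap f), aeval (f t) (p.map j) = f (aeval t p) := by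
      intro p
      rw [aeval_def, eval₂_map, aeval_def, hom_eval₂]
      congr 1
    refine h.root (g.map j) (f t) (hg.map _) ?_ ?_
    · rw [key, ht, map_zero]
    · rw [derivative_map, key]; exact hu.map f

variable {S : Type*} [CommRing S] [IsDomain S]

/-- polynomials with coefficients algebraic over `P` -/
noncomputable def algPoly (P : Subring S) : Subring S[X] :=
  (mapRingHom (Subalgebra.algebraicClosure P S).toSubring.subtype).range

lemma mem_algPoly {P : Subring S} {f : S[X]} :
    f ∈ algPoly P ↔ ∀ i, IsAlgebraic P (f.coeff i) := by
  have h1 : f ∈ algPoly P ↔ f ∈ lifts (Subalgebra.algebraicClosure P S).toSubring.subtype := by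
    rfl
  rw [h1, lifts_iff_coeff_lifts]
  refine forall_congr' fun i => ⟨?_, fun h => ⟨⟨_, h⟩, rfl⟩⟩
  rintro ⟨y, hy⟩
  rw [← hy]; exact y.2

lemma algPoly_div {P : Subring S} {f g : S[X]} (hf : f ∈ algPoly P) (hg : g ∈ algPoly P)
    (hm : g.Monic) : f /ₘ g ∈ algPoly P := by
  obtain ⟨f, rfl⟩ := hf
  obtain ⟨g, rfl⟩ := hg
  have hm' : g.Monic := (Function.Injective.monic_map_iff (Subtype.val_injective)).2 hm
  rw [coe_mapRingHom, ← map_divByMonic _ hm']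
  exact ⟨_, rfl⟩

lemma algPoly_X {P : Subring S} : (Polynomial.X : S[X]) ∈ algPoly P := ⟨Polynomial.X, by simp⟩

lemma algPoly_factor {P : Subring S} {f g h : S[X]} (hf : f ∈ algPoly P) (hf0 : f ≠ 0)
    (hm : g.Monic) (h : f = g * h) : g ∈ algPoly P := by
  rw [mem_algPoly] at *
  let E := AlgebraicClosure (FractionRing S)
  have hinj : Function.Injective (algebraMap S E) := by
    rw [IsScalarTower.algebraMap_eq S (FractionRing S) E]
    exact (algebraMap (FractionRing S) E).injective.comp (IsFractionRing.injective _ _)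
  intro i
  have := coeff_mem_of_roots (algSubfield P E) (hm.map (algebraMap S E)) ?_ i
  · rw [Polynomial.coeff_map] at this
    exact (isAlgebraic_algebraMap_iff hinj).1 this
  · intro x hx
    refine isAlgebraic_of_root (f.map (algebraMap S E)) ?_ ?_ x ?_
    · rwa [Ne, Polynomial.map_eq_zero_iff hinj]
    · intro i
      rw [Polynomial.coeff_map]; exact (hf i).algebraMap
    · rw [h, Polynomial.map_mul, eval_mul, hx, zero_mul]

lemma algPoly_eval₂ {P : Subring S} {R : Type*} [CommRing R] (ι : R →+* S[X])
    (hι : ∀ r, ι r ∈ algPoly P) {c : S[X]} (hc : c ∈ algPoly P) (q : R[X]) :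
    eval₂ ι c q ∈ algPoly P := by
  rw [eval₂_eq_sum_range]
  exact sum_mem fun j _ => mul_mem (hι _) (pow_mem hc _)

variable [IsLocalRing S]

lemma key_step [IsAdicComplete (maximalIdeal S) S]
    [IsAdicComplete (maximalIdeal S⟦X⟧) S⟦X⟧] (P : Subring S) (hP : AlgHens P)
    (H : Subring S⟦X⟧) (hH : HClosed (algebraMap P[X] S⟦X⟧).range H)
    (φ : S⟦X⟧) (q b : P[X][X]) (D : P[X]) (hq0 : q ≠ 0) (hq : aeval φ q = 0)
    (hD : aeval φ b * aeval φ (derivative q) = algebraMap P[X] S⟦X⟧ D)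
    (hD0 : (algebraMap P[X] S⟦X⟧ D).map (residue S) ≠ 0) : φ ∈ H := by
  -- constants
  have hS0 : ∀ a : S, IsAlgebraic P a → PowerSeries.C a ∈ H := by
    refine hP _ (hH.comap (PowerSeries.C (R := S)) ?_)
    intro x hx
    refine ⟨Polynomial.C ⟨x, hx⟩, ?_⟩
    rw [PowerSeries.algebraMap_apply', Polynomial.coe_C, PowerSeries.map_C]
    rfl
  have hXH : (PowerSeries.X : S⟦X⟧) ∈ H := hH.le ⟨Polynomial.X, by
    rw [PowerSeries.algebraMap_apply', Polynomial.coe_X, PowerSeries.map_X]⟩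
  set T := algPoly P with hT
  have hTH : ∀ f ∈ T, (f : S⟦X⟧) ∈ H := by
    intro f hf
    have : (f : S⟦X⟧) = ∑ i ∈ Finset.range (f.natDegree + 1), PowerSeries.C (f.coeff i) * PowerSeries.X ^ i := by
      conv_lhs => rw [f.as_sum_range_C_mul_X_pow]
      have := map_sum (Polynomial.coeToPowerSeries.ringHom (R := S)) (fun i => Polynomial.C (f.coeff i) * Polynomial.X ^ i) (Finset.range (f.natDegree + 1))
      refine Eq.trans this ?_
      refine Finset.sum_congr rfl fun i _ => ?_
      simp
    rw [this]
    exact sum_mem fun i _ => mul_mem (hS0 _ (mem_algPoly.1 hf i)) (pow_mem hXH i)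
  set ι : P[X] →+* S[X] := mapRingHom (algebraMap P S) with hι
  have hιco : ∀ p : P[X], ((ι p : S[X]) : S⟦X⟧) = algebraMap P[X] S⟦X⟧ p := by
    intro p
    rw [PowerSeries.algebraMap_apply', hι, coe_mapRingHom, Polynomial.polynomial_map_coe]
  have hιT : ∀ p, ι p ∈ T := by
    intro p
    rw [hT, mem_algPoly]
    intro i
    rw [hι, coe_mapRingHom, Polynomial.coeff_map]
    exact isAlgebraic_algebraMap _
  have hev : ∀ (c : S[X]) (p : P[X][X]), ((eval₂ ι c p : S[X]) : S⟦X⟧) = aeval (c : S⟦X⟧) p := by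
    intro c p
    have := Polynomial.hom_eval₂ p ι (Polynomial.coeToPowerSeries.ringHom (R := S)) c
    refine Eq.trans this ?_
    rw [aeval_def]
    congr 1
    ext p : 1
    · ext p; exact congrArg _ (hιco (Polynomial.C p))
    · exact hιco Polynomial.X
  obtain ⟨W, u, hWu⟩ := exists_isWeierstrassFactorization hD0
  obtain ⟨hWd, hu, hDW⟩ := hWu
  rw [← hιco] at hDW
  obtain ⟨huU, hDU⟩ := wd_poly hWd hDW
  set U := ι D /ₘ W with hU
  have hD0' : ι D ≠ 0 := by
    intro h
    apply hD0
    rw [← hιco, h]; simp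
  have hWT : W ∈ T := algPoly_factor (h := U) (hιT D) hD0' hWd.monic hDU
  have hUT : U ∈ T := algPoly_div (hιT D) hWT hWd.monic
  have hXd : (Polynomial.X : S[X]).IsDistinguishedAt (maximalIdeal S) := by
    refine ⟨⟨fun {n} hn => ?_⟩, monic_X⟩
    rw [natDegree_X] at hn
    obtain rfl : n = 0 := by omega
    simp
  set V := (W * W) * (Polynomial.X * Polynomial.X) with hVdef
  have hV : V.IsDistinguishedAt (maximalIdeal S) := (hWd.mul hWd).mul (hXd.mul hXd)
  have hVT : V ∈ T := mul_mem (mul_mem hWT hWT) (mul_mem algPoly_X algPoly_X)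
  have hm : 2 ≤ V.natDegree := by
    rw [hVdef, (hWd.mul hWd).monic.natDegree_mul (hXd.mul hXd).monic,
      monic_X.natDegree_mul monic_X, natDegree_X]
    omega
  obtain ⟨s, c, hφ, hc⟩ := wd_exists hV φ
  have hcT : c ∈ T := mem_algPoly.2
    (rem_alg P hV hm (mem_algPoly.1 hVT) φ s c ⟨q, hq0, hq⟩ hφ hc)
  have hdiff : ∀ p : P[X][X], ∃ g, aeval (c : S⟦X⟧) p = aeval φ p + V * g := by
    intro p
    obtain ⟨g, hg⟩ := Polynomial.sub_dvd_eval_sub (c : S⟦X⟧) φ (p.map (algebraMap P[X] S⟦X⟧))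
    rw [eval_map_algebraMap, eval_map_algebraMap] at hg
    refine ⟨- s * g, ?_⟩
    rw [sub_eq_iff_eq_add.1 hg]
    linear_combination (- g) * hφ
  set qc := eval₂ ι c q with hqc
  have hqcT : qc ∈ T := algPoly_eval₂ ι hιT hcT q
  set bc := eval₂ ι c b with hbc
  have hbcT : bc ∈ T := algPoly_eval₂ ι hιT hcT b
  set qd := eval₂ ι c (derivative q) with hqd
  have hqdT : qd ∈ T := algPoly_eval₂ ι hιT hcT _
  obtain ⟨e1, he1T, he1⟩ : ∃ e1 ∈ T, qc = V * e1 := by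
    obtain ⟨g, hg⟩ := hdiff q
    rw [hq, zero_add, ← hev] at hg
    exact ⟨_, algPoly_div hqcT hVT hV.monic, (wd_poly hV hg).2⟩
  obtain ⟨e2, he2T, he2⟩ : ∃ e2 ∈ T, bc * qd - ι D = V * e2 := by
    obtain ⟨g, hg⟩ := hdiff (b * derivative q)
    rw [map_mul, map_mul, hD, ← hev, ← hev, ← hιco, ← hbc, ← hqd] at hg
    have hg' : ((bc * qd - ι D : S[X]) : S⟦X⟧) = V * g := by
      rw [Polynomial.coe_sub, Polynomial.coe_mul, hg]; ring
    exact ⟨_, algPoly_div (sub_mem (mul_mem hbcT hqdT) (hιT D)) hVT hV.monic, (wd_poly hV hg').2⟩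
  set u2 := U + W * (Polynomial.X * Polynomial.X) * e2 with hu2
  have hu2T : u2 ∈ T := add_mem hUT (mul_mem (mul_mem hWT (mul_mem algPoly_X algPoly_X)) he2T)
  have hbq : bc * qd = W * u2 := by
    rw [hu2]
    linear_combination he2 + hDU
  have hu2u : IsUnit (u2 : S⟦X⟧) := by
    rw [huU, PowerSeries.isUnit_iff_constantCoeff] at hu
    rw [PowerSeries.isUnit_iff_constantCoeff, hu2]
    simpa using hu
  have hW0 : (W : S⟦X⟧) ≠ 0 := by
    rw [Ne, Polynomial.coe_eq_zero_iff]; exact hWd.monic.ne_zero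
  set y : S⟦X⟧ := (W : S⟦X⟧) * (PowerSeries.X * PowerSeries.X) * s with hy
  have hynu : ¬ IsUnit y := by
    rw [PowerSeries.isUnit_iff_constantCoeff, hy]; simp
  have hφy : φ = c + W * y := by
    rw [hφ, hy, hVdef]
    simp only [Polynomial.coe_mul, Polynomial.coe_X]
    ring
  -- move to H
  let κ : P[X] →+* H := (algebraMap P[X] S⟦X⟧).codRestrict H (fun p => hH.le ⟨p, rfl⟩)
  have hκ : ∀ (p : P[X][X]) (z : S⟦X⟧), aeval z (p.map κ) = aeval z p := by
    intro p z
    rw [aeval_def, eval₂_map, aeval_def]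
    congr 1
  let cH : H := ⟨c, hTH c hcT⟩
  let WH : H := ⟨W, hTH W hWT⟩
  have hκ' : ∀ p : P[X][X], ((eval cH (p.map κ) : H) : S⟦X⟧) = aeval (c : S⟦X⟧) p := by
    intro p
    rw [← hκ, ← subring_algebraMap, ← Polynomial.aeval_algebraMap_apply_eq_algebraMap_eval]
    rfl
  obtain ⟨G, hG⟩ := taylor_quad H (q.map κ) cH
  have hG1 := hG (W * y)
  rw [derivative_map, hκ', hκ', hκ, ← hev, ← hev, ← hqc, ← hqd] at hG1
  change aeval ((c : S⟦X⟧) + W * y) q = _ at hG1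
  rw [← hφy, hq] at hG1
  set G' : Polynomial H := G.comp (Polynomial.C WH * Polynomial.X) with hG'
  have hG'e : aeval y G' = aeval ((W : S⟦X⟧) * y) G := by
    rw [hG', aeval_comp]
    congr 2
    simp [subring_algebraMap, WH]
  have hyH : y ∈ H := by
    refine hH.nonmonic ⟨_, hTH _ (mul_mem hbcT (mul_mem (mul_mem algPoly_X algPoly_X) he1T))⟩
      ⟨u2, hTH u2 hu2T⟩ (Polynomial.C ⟨bc, hTH bc hbcT⟩ * G') y hynu hu2u ?_
    rw [map_mul, aeval_C, subring_algebraMap, hG'e]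
    apply mul_left_cancel₀ (mul_ne_zero hW0 hW0)
    have hbq' : (bc : S⟦X⟧) * qd = W * u2 := by
      rw [← Polynomial.coe_mul, hbq, Polynomial.coe_mul]
    have he1' : (qc : S⟦X⟧) = (W : S⟦X⟧) * (W : S⟦X⟧) * (PowerSeries.X * PowerSeries.X) * (e1 : S⟦X⟧) := by
      rw [he1, hVdef]; simp
    rw [he1'] at hG1
    simp only [Polynomial.coe_mul, Polynomial.coe_X, mul_zero]
    linear_combination (-(bc : S⟦X⟧)) * hG1 - (W : S⟦X⟧) * y * hbq'
  rw [hφy]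
  exact add_mem (hTH c hcT) (mul_mem (hTH W hWT) hyH)

end KeyStep


section MvSec
set_option linter.unusedSectionVars false
open IsLocalRing

variable {K : Type*} [Field K] {n : ℕ}

lemma mv_mem_span_aux (T : Finset (Fin n)) : ∀ f : MvPowerSeries (Fin n) K,
    (∀ m : Fin n →₀ ℕ, (∀ i ∈ T, m i = 0) → MvPowerSeries.coeff m f = 0) →
    f ∈ Ideal.span (Set.range (MvPowerSeries.X : Fin n → MvPowerSeries (Fin n) K)) := by
  classical
  induction T using Finset.induction_on with
  | empty =>
    intro f hf
    have : f = 0 := by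
      ext m; exact hf m (by simp)
    rw [this]; exact zero_mem _
  | insert i T hi ih =>
    intro f hf
    let f1 : MvPowerSeries (Fin n) K := fun m => if m i = 0 then 0 else MvPowerSeries.coeff m f
    have hf1 : ∀ m, MvPowerSeries.coeff m f1 = if m i = 0 then 0 else MvPowerSeries.coeff m f :=
      fun m => rfl
    have h1 : MvPowerSeries.X i ∣ f1 := by
      rw [MvPowerSeries.X_dvd_iff]
      intro m hm
      rw [hf1, if_pos hm]
    have h2 : f - f1 ∈ Ideal.span (Set.range (MvPowerSeries.X : Fin n → MvPowerSeries (Fin n) K)) := by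
      apply ih
      intro m hm
      rw [map_sub, hf1]
      split_ifs with h
      · rw [sub_zero]
        apply hf
        intro j hj
        rcases Finset.mem_insert.1 hj with rfl | hj
        · exact h
        · exact hm j hj
      · rw [sub_self]
    have h3 : f1 ∈ Ideal.span (Set.range (MvPowerSeries.X : Fin n → MvPowerSeries (Fin n) K)) :=
      Ideal.mem_of_dvd _ h1 (Ideal.subset_span ⟨i, rfl⟩)
    have := add_mem h2 h3
    rwa [sub_add_cancel] at this

lemma mv_not_isUnit_iff (f : MvPowerSeries (Fin n) K) :
    ¬ IsUnit f ↔ MvPowerSeries.constantCoeff f = 0 := by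
  rw [MvPowerSeries.isUnit_iff_constantCoeff, isUnit_iff_ne_zero, not_not]

lemma mv_mem_maximalIdeal (f : MvPowerSeries (Fin n) K) :
    f ∈ maximalIdeal (MvPowerSeries (Fin n) K) ↔ MvPowerSeries.constantCoeff f = 0 :=
  mv_not_isUnit_iff f

lemma mv_maximalIdeal : maximalIdeal (MvPowerSeries (Fin n) K) =
    Ideal.span (Set.range (MvPowerSeries.X : Fin n → MvPowerSeries (Fin n) K)) := by
  apply le_antisymm
  · intro f hf
    rw [mv_mem_maximalIdeal] at hf
    apply mv_mem_span_aux Finset.univ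
    intro m hm
    have : m = 0 := by ext i; simpa using hm i (Finset.mem_univ i)
    rw [this]; exact hf
  · rw [Ideal.span_le]
    rintro _ ⟨i, rfl⟩
    rw [SetLike.mem_coe, mv_mem_maximalIdeal, MvPowerSeries.constantCoeff_X]

instance mv_complete : IsAdicComplete (maximalIdeal (MvPowerSeries (Fin n) K))
    (MvPowerSeries (Fin n) K) := by
  rw [mv_maximalIdeal]; infer_instance

instance mv_complete' : IsAdicComplete (maximalIdeal (PowerSeries (MvPowerSeries (Fin n) K)))
    (PowerSeries (MvPowerSeries (Fin n) K)) := by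
  have h : IsAdicComplete (maximalIdeal (MvPowerSeries (Fin (n + 1)) K))
    (MvPowerSeries (Fin (n + 1)) K) := inferInstance
  let e := (MvPowerSeries.finSuccEquiv K n).toRingEquiv
  rw [← IsAdicComplete.congr_ringEquiv _ e] at h
  have : (maximalIdeal (MvPowerSeries (Fin (n + 1)) K)).map e =
      maximalIdeal (PowerSeries (MvPowerSeries (Fin n) K)) := by
    apply IsLocalRing.eq_maximalIdeal
    exact Ideal.map_isMaximal_of_equiv e
  rwa [this] at h

/-- the subring of polynomials -/
noncomputable def polSub (K : Type*) [Field K] (n : ℕ) : Subring (MvPowerSeries (Fin n) K) :=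
  (MvPolynomial.coeToMvPowerSeries.ringHom (R := K) (σ := Fin n)).range

lemma mem_polSub_of_finite (f : MvPowerSeries (Fin n) K)
    (hf : {m | MvPowerSeries.coeff m f ≠ 0}.Finite) : f ∈ polSub K n := by
  classical
  let p : MvPolynomial (Fin n) K := ∑ m ∈ hf.toFinset, MvPolynomial.monomial m (MvPowerSeries.coeff m f)
  refine ⟨p, ?_⟩
  ext m
  simp only [MvPolynomial.coeToMvPowerSeries.ringHom_apply, MvPolynomial.coeff_coe, p,
    MvPolynomial.coeff_sum, MvPolynomial.coeff_monomial, Finset.sum_ite_eq', Set.Finite.mem_toFinset,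
    Set.mem_ofPred_eq]
  split_ifs with h
  · rfl
  · push Not at h; exact h.symm

lemma finite_of_mem_polSub {f : MvPowerSeries (Fin n) K} (hf : f ∈ polSub K n) :
    {m | MvPowerSeries.coeff m f ≠ 0}.Finite := by
  obtain ⟨p, rfl⟩ := hf
  refine p.support.finite_toSet.subset ?_
  intro m hm
  simpa using hm

lemma exists_frob_functional (p : ℕ) [hp : Fact p.Prime] [CharP K p] (c : K) (hc : c ≠ 0) :
    ∃ L : K →+ K, (∀ x y, L (x ^ p * y) = x * L y) ∧ L c ≠ 0 := by
  let F := (frobenius K p).fieldRange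
  obtain ⟨f, hf⟩ := Module.Projective.exists_dual_ne_zero F hc
  let e : K ≃+* F := (frobenius K p).rangeRestrictFieldEquiv
  refine ⟨(e.symm : F →+ K).comp f.toAddMonoidHom, ?_, ?_⟩
  · intro x y
    have h1 : x ^ p * y = (e x) • y := by
      rw [Subfield.smul_def]; rfl
    change e.symm (f (x ^ p * y)) = x * e.symm (f y)
    rw [h1, map_smul, smul_eq_mul, map_mul, RingEquiv.symm_apply_apply]
  · change e.symm (f c) ≠ 0
    rw [Ne, map_eq_zero_iff _ e.symm.injective]; exact hf

lemma exists_Lam (p : ℕ) [hp : Fact p.Prime] [CharP K p] (a : MvPowerSeries (Fin n) K)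
    (ha : a ≠ 0) : ∃ Λ : MvPowerSeries (Fin n) K →+ MvPowerSeries (Fin n) K,
      (∀ g f, Λ (g ^ p * f) = g * Λ f) ∧ Λ a ≠ 0 ∧ ∀ f ∈ polSub K n, Λ f ∈ polSub K n := by
  classical
  have hp0 : p ≠ 0 := hp.out.ne_zero
  obtain ⟨γ, hγ⟩ : ∃ γ, MvPowerSeries.coeff γ a ≠ 0 := by
    by_contra! h
    exact ha (MvPowerSeries.ext (by simpa using h))
  obtain ⟨L, hL, hLc⟩ := exists_frob_functional p _ hγ
  let α : Fin n →₀ ℕ := γ.mapRange (· % p) (Nat.zero_mod p)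
  let γ' : Fin n →₀ ℕ := γ.mapRange (· / p) (Nat.zero_div p)
  have hαγ : p • γ' + α = γ := by
    ext i; simp [α, γ', Nat.div_add_mod]
  have hαp : ∀ i, α i < p := fun i => by simp [α, Nat.mod_lt _ hp.out.pos]
  let Λ : MvPowerSeries (Fin n) K →+ MvPowerSeries (Fin n) K :=
    { toFun := fun f β => L (MvPowerSeries.coeff (p • β + α) f)
      map_zero' := by funext β; simp; rfl
      map_add' := fun f g => by funext β; simp; rfl }
  have hΛ : ∀ f β, MvPowerSeries.coeff β (Λ f) = L (MvPowerSeries.coeff (p • β + α) f) :=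
    fun f β => rfl
  have hinj : Function.Injective (fun β : Fin n →₀ ℕ => p • β + α) := by
    intro β β' h
    ext i
    have := DFunLike.congr_fun h i
    simpa [hp0] using this
  refine ⟨Λ, ?_, ?_, ?_⟩
  · intro g f
    ext β
    have hg : g ^ p = MvPowerSeries.expand p hp0 (MvPowerSeries.map (frobenius K p) g) := by
      haveI : ExpChar K p := ExpChar.prime hp.out
      rw [← MvPowerSeries.map_expand]
      exact (MvPowerSeries.map_frobenius_expand p hp0).symm
    rw [hΛ, MvPowerSeries.coeff_mul, MvPowerSeries.coeff_mul, map_sum]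
    symm
    apply Finset.sum_of_injOn (fun x => (p • x.1, p • x.2 + α))
    · rintro ⟨x1, x2⟩ _ ⟨y1, y2⟩ _ h
      simp only [Prod.mk.injEq] at h
      have h1 : x1 = y1 := by
        ext i
        have := DFunLike.congr_fun h.1 i
        simpa [hp0] using this
      rw [h1, hinj h.2]
    · rintro ⟨x1, x2⟩ hx
      simp only [SetLike.mem_coe, Finset.HasAntidiagonal.mem_antidiagonal] at hx ⊢
      rw [← hx, smul_add, add_assoc]
    · rintro ⟨u, v⟩ huv hnot
      rw [Finset.HasAntidiagonal.mem_antidiagonal] at huv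
      simp only at huv
      by_cases hd : ∀ i, p ∣ u i
      · exfalso
        apply hnot
        let u' : Fin n →₀ ℕ := u.mapRange (· / p) (Nat.zero_div p)
        have hu' : p • u' = u := by
          ext i; simp [u', Nat.mul_div_cancel' (hd i)]
        have hle : u' ≤ β := by
          intro i
          have h1 := DFunLike.congr_fun huv i
          rw [← hu'] at h1
          simp only [Finsupp.add_apply, Finsupp.smul_apply, smul_eq_mul] at h1
          have h2 := hαp i
          by_contra! hc
          have : p * (β i + 1) ≤ p * u' i := Nat.mul_le_mul_left p hc
          rw [Nat.mul_add] at this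
          omega
        refine ⟨(u', β - u'), ?_, ?_⟩
        · simp [add_tsub_cancel_of_le hle]
        · simp only [Prod.mk.injEq]
          refine ⟨hu', ?_⟩
          have h3 : u' + (β - u') = β := add_tsub_cancel_of_le hle
          rw [← h3, smul_add, hu', add_assoc] at huv
          exact (add_left_cancel huv).symm
      · push Not at hd
        obtain ⟨i, hi⟩ := hd
        simp only
        rw [hg, MvPowerSeries.coeff_expand_of_not_dvd p hp0 _ hi, zero_mul, map_zero]
    · rintro ⟨x1, x2⟩ _
      simp only
      rw [hΛ, hg, MvPowerSeries.coeff_expand_smul, MvPowerSeries.coeff_map, frobenius_def, hL]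
  · intro h
    have := congrArg (MvPowerSeries.coeff γ') h
    rw [hΛ, hαγ, map_zero] at this
    exact hLc this
  · intro f hf
    apply mem_polSub_of_finite
    refine ((finite_of_mem_polSub hf).preimage hinj.injOn).subset ?_
    intro β hβ
    simp only [Set.mem_preimage, Set.mem_ofPred_eq] at hβ ⊢
    intro h
    apply hβ
    rw [hΛ, h, map_zero]

end MvSec


section MvSep
set_option linter.unusedSectionVars false
open Polynomial

variable {K : Type*} [Field K] {n : ℕ}

lemma exists_sep_aux (φ : MvPowerSeries (Fin n) K) (d : ℕ) :
    ∀ q : (polSub K n)[X], q.natDegree = d → q ≠ 0 → aeval φ q = 0 →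
    ∃ q : (polSub K n)[X], q ≠ 0 ∧ aeval φ q = 0 ∧ aeval φ (derivative q) ≠ 0 := by
  classical
  induction d using Nat.strong_induction_on with
  | _ d ih =>
    intro q hd hq0 hq
    by_cases h1 : aeval φ (derivative q) = 0
    swap
    · exact ⟨q, hq0, hq, h1⟩
    have hdeg : q.natDegree ≠ 0 := by
      intro h
      obtain ⟨a, rfl⟩ := natDegree_eq_zero.1 h
      rw [aeval_C, subring_algebraMap] at hq
      apply hq0
      rw [C_eq_zero]
      exact Subtype.ext hq
    by_cases h2 : derivative q = 0
    swap
    · exact ih _ (by rw [← hd]; exact natDegree_derivative_lt hdeg) _ rfl h2 h1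
    obtain ⟨p, hp⟩ := CharP.exists K
    have hinjK : Function.Injective (algebraMap K (MvPowerSeries (Fin n) K)) :=
      (algebraMap K (MvPowerSeries (Fin n) K)).injective
    have hpA : CharP (MvPowerSeries (Fin n) K) p := charP_of_injective_algebraMap hinjK p
    have hpP : CharP (polSub K n) p :=
      ((polSub K n).subtype.charP_iff Subtype.val_injective p).2 hpA
    rcases CharP.char_is_prime_or_zero K p with hprime | rfl
    swap
    · have : CharZero (polSub K n) := CharP.charP_to_charZero _
      exact absurd (natDegree_eq_zero_of_derivative_eq_zero h2) hdeg
    have : Fact p.Prime := ⟨hprime⟩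
    have hex := expand_contract p h2 hprime.ne_zero
    set q1 := contract p q with hq1
    have hq10 : q1 ≠ 0 := by
      rintro h; rw [h, map_zero] at hex; exact hq0 hex.symm
    obtain ⟨i, hi⟩ : ∃ i, q1.coeff i ≠ 0 := by
      by_contra! h
      exact hq10 (Polynomial.ext (by simpa using h))
    obtain ⟨Λ, hΛ, hΛa, hΛP⟩ := exists_Lam p ((q1.coeff i : polSub K n) : MvPowerSeries (Fin n) K)
      (fun h => hi (Subtype.ext h))
    let c : ℕ → polSub K n := fun j => ⟨Λ (q1.coeff j : polSub K n), hΛP _ (q1.coeff j).2⟩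
    let q2 : (polSub K n)[X] := ∑ j ∈ Finset.range (q1.natDegree + 1), monomial j (c j)
    have hq2c : q2.coeff i = c i := by
      simp only [q2, finsetSum_coeff, coeff_monomial, Finset.sum_ite_eq', Finset.mem_range]
      rw [if_pos]
      exact Nat.lt_succ_of_le (le_natDegree_of_ne_zero hi)
    have hq2d : q2.natDegree ≤ q1.natDegree := by
      apply natDegree_sum_le_of_forall_le
      intro j hj
      refine (natDegree_monomial_le _).trans ?_
      rw [Finset.mem_range] at hj; omega
    have hdq : q.natDegree = q1.natDegree * p := by rw [← hex, natDegree_expand]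
    refine ih q2.natDegree ?_ q2 rfl ?_ ?_
    · have h2p := hprime.two_le
      have : q1.natDegree ≠ 0 := by rintro h; rw [h, zero_mul] at hdq; exact hdeg hdq
      rw [← hd, hdq]
      refine hq2d.trans_lt ?_
      nlinarith [Nat.pos_of_ne_zero this]
    · intro h
      rw [h, coeff_zero] at hq2c
      exact hΛa (congrArg Subtype.val hq2c.symm)
    · rw [← hex, expand_aeval, aeval_eq_sum_range] at hq
      have h5 := congrArg Λ hq
      rw [map_sum, map_zero] at h5
      rw [map_sum, ← h5]
      refine Finset.sum_congr rfl fun j _ => ?_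
      rw [aeval_monomial, Algebra.smul_def, subring_algebraMap, subring_algebraMap, ← pow_mul,
        mul_comm p j, pow_mul, mul_comm ((q1.coeff j : polSub K n) : MvPowerSeries (Fin n) K), hΛ,
        mul_comm]

lemma exists_sep (φ : MvPowerSeries (Fin n) K) (hφ : IsAlgebraic (polSub K n) φ) :
    ∃ q : (polSub K n)[X], q ≠ 0 ∧ aeval φ q = 0 ∧ aeval φ (derivative q) ≠ 0 := by
  obtain ⟨q, h1, h2⟩ := hφ
  exact exists_sep_aux φ _ q rfl h1 h2

lemma exists_shift (d : MvPolynomial (Fin (n + 1)) K) (hd : d ≠ 0) :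
    ∃ e : Fin n → ℕ, (∀ i, e i ≠ 0) ∧
      MvPolynomial.aeval (Fin.cons X (fun i => X ^ e i) : Fin (n + 1) → K[X]) d ≠ 0 := by
  classical
  set r := d.totalDegree + 2 with hr
  refine ⟨fun i => r ^ (i.succ : ℕ), fun i => by positivity, ?_⟩
  have hcons : (Fin.cons X (fun i : Fin n => X ^ (r ^ (i.succ : ℕ))) : Fin (n + 1) → K[X]) =
      fun i : Fin (n + 1) => X ^ (r ^ (i : ℕ)) := by
    funext i
    refine Fin.cases ?_ (fun i => ?_) i
    · simp
    · simp
  rw [hcons]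
  obtain ⟨v, hv⟩ : ∃ v, d.coeff v ≠ 0 := by
    by_contra! h
    exact hd (MvPolynomial.ext _ _ (by simpa using h))
  have hlt : ∀ w : Fin (n + 1) →₀ ℕ, d.coeff w ≠ 0 → ∀ i, w i < r := by
    intro w hw i
    have h1 := MvPolynomial.le_totalDegree (p := d) (MvPolynomial.mem_support_iff.2 hw)
    have h2 : w i ≤ w.sum fun _ e => e := by
      by_cases h : w i = 0
      · omega
      · rw [Finsupp.sum]
        exact Finset.single_le_sum (f := fun i => w i) (fun _ _ => Nat.zero_le _) (Finsupp.mem_support_iff.2 h)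
    omega
  have hne : ∀ w : Fin (n + 1) →₀ ℕ, d.coeff w ≠ 0 →
      ∑ i : Fin (n + 1), r ^ (i : ℕ) * w i = ∑ i : Fin (n + 1), r ^ (i : ℕ) * v i → w = v := by
    intro w hw h
    refine Finsupp.ext <| congrFun <| List.ofFn_inj.mp ?_
    apply Nat.ofDigits_inj_of_len_eq (b := r) (by omega) (by simp)
    · intro x hx
      rw [List.mem_ofFn'] at hx
      obtain ⟨i, rfl⟩ := hx
      exact hlt w hw i
    · intro x hx
      rw [List.mem_ofFn'] at hx
      obtain ⟨i, rfl⟩ := hx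
      exact hlt v hv i
    · simpa only [Nat.ofDigits_eq_sum_mapIdx, List.mapIdx_eq_ofFn, List.get_ofFn, List.length_ofFn,
        Fin.val_cast, mul_comm, List.sum_ofFn] using! h
  intro h
  have hc := congrArg (fun f => Polynomial.coeff f (∑ i : Fin (n + 1), r ^ (i : ℕ) * v i)) h
  simp only [MvPolynomial.aeval_def, MvPolynomial.eval₂_eq', ← pow_mul, Finset.prod_pow_eq_pow_sum,
    finsetSum_coeff, coeff_zero, Polynomial.algebraMap_apply, Algebra.algebraMap_self, RingHom.id_apply,
    coeff_C_mul, coeff_X_pow, MvPolynomial.algebraMap_eq] at hc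
  rw [Finset.sum_eq_single v] at hc
  · simp at hc; exact hv hc
  · intro w hw hwv
    rw [if_neg, mul_zero]
    intro h'
    exact hwv (hne w (MvPolynomial.mem_support_iff.1 hw) h'.symm)
  · intro hv'
    exact absurd (MvPolynomial.mem_support_iff.2 hv) hv'

end MvSep


section CoordSec
set_option linter.unusedSectionVars false
open Polynomial IsLocalRing
open PowerSeries (map)

lemma key_step' {S : Type*} [CommRing S] [IsDomain S] [IsLocalRing S]
    [IsAdicComplete (maximalIdeal S) S]
    [IsAdicComplete (maximalIdeal (PowerSeries S)) (PowerSeries S)]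
    (P : Subring S) (hP : AlgHens P) {O : Type*} [CommRing O] (θ : O ≃+* PowerSeries S)
    (Q : Subring O) (hQ : ∀ x, x ∈ Q ↔ θ x ∈ (algebraMap P[X] (PowerSeries S)).range)
    (H : Subring O) (hH : HClosed Q H) (φ : O) (q b : Q[X]) (D : Q) (hq0 : q ≠ 0)
    (hq : aeval φ q = 0) (hD : aeval φ b * aeval φ (derivative q) = D)
    (hD0 : (θ D).map (residue S) ≠ 0) : φ ∈ H := by
  have hinj : Function.Injective (algebraMap P[X] (PowerSeries S)) := by
    intro x y h
    ext i
    have := congrArg (PowerSeries.coeff i) h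
    simpa [PowerSeries.algebraMap_apply', subring_algebraMap] using this
  let e : P[X] ≃+* (algebraMap P[X] (PowerSeries S)).range :=
    RingEquiv.ofBijective (algebraMap P[X] (PowerSeries S)).rangeRestrict
      ⟨fun x y h => hinj (congrArg Subtype.val h), (algebraMap P[X] (PowerSeries S)).rangeRestrict_surjective⟩
  have he : ∀ y, algebraMap P[X] (PowerSeries S) (e.symm y) = y := fun y =>
    congrArg Subtype.val (e.apply_symm_apply y)
  let ι : Q →+* P[X] := (e.symm : _ →+* P[X]).comp
    (((θ : O →+* PowerSeries S).comp Q.subtype).codRestrict _ fun x => (hQ x).1 x.2)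
  have hι : ∀ x : Q, algebraMap P[X] (PowerSeries S) (ι x) = θ x := fun x => he _
  have hιinj : Function.Injective ι := by
    intro x y h
    have := congrArg (algebraMap P[X] (PowerSeries S)) h
    rw [hι, hι] at this
    exact Subtype.ext (θ.injective this)
  have hιc : (algebraMap P[X] (PowerSeries S)).comp ι = (θ : O →+* PowerSeries S).comp (algebraMap Q O) := by
    ext1 x; exact hι x
  have hev : ∀ p : Q[X], aeval (θ φ) (p.map ι) = θ (aeval φ p) := by
    intro p
    rw [aeval_def, eval₂_map, hιc, aeval_def]
    exact (hom_eval₂ p (algebraMap Q O) (θ : O →+* PowerSeries S) φ).symm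
  have := key_step P hP (H.comap (θ.symm : PowerSeries S →+* O)) (hH.comap _ ?_) (θ φ) (q.map ι) (b.map ι) (ι D)
    ?_ ?_ ?_ ?_
  · simpa using this
  · intro x hx
    rw [hQ]; simpa using hx
  · rwa [Ne, Polynomial.map_eq_zero_iff hιinj]
  · rw [hev, hq, map_zero]
  · rw [derivative_map, hev, hev, ← map_mul, hD, hι]
  · rw [hι]; exact hD0

variable {K : Type*} [Field K] {n : ℕ}

/-- shear substitution -/
noncomputable def shr (e : Fin n → ℕ) (c : K) : Fin (n + 1) → MvPowerSeries (Fin (n + 1)) K :=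
  Fin.cons (MvPowerSeries.X 0) (fun i => MvPowerSeries.X i.succ + MvPowerSeries.C c * MvPowerSeries.X 0 ^ e i)

lemma shr_hasSubst (e : Fin n → ℕ) (he : ∀ i, e i ≠ 0) (c : K) : MvPowerSeries.HasSubst (shr e c) := by
  apply MvPowerSeries.hasSubst_of_constantCoeff_zero
  intro i
  refine Fin.cases ?_ (fun i => ?_) i
  · simp [shr]
  · simp [shr, he i]

lemma shr_comp (e : Fin n → ℕ) (he : ∀ i, e i ≠ 0) (c d : K) (hcd : c + d = 0) (f : MvPowerSeries (Fin (n + 1)) K) :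
    MvPowerSeries.substAlgHom (shr_hasSubst e he c) (MvPowerSeries.substAlgHom (shr_hasSubst e he d) f) = f := by
  rw [MvPowerSeries.substAlgHom_comp_substAlgHom_apply]
  have : (fun s => MvPowerSeries.substAlgHom (shr_hasSubst e he c) (shr e d s)) = MvPowerSeries.X := by
    funext s
    refine Fin.cases ?_ (fun i => ?_) s
    · rw [show shr e d 0 = MvPowerSeries.X 0 from rfl, MvPowerSeries.substAlgHom_X]; rfl
    · have : MvPowerSeries.substAlgHom (shr_hasSubst e he c) (MvPowerSeries.C d) = MvPowerSeries.C d := 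
        AlgHom.commutes _ d
      rw [show shr e d i.succ = MvPowerSeries.X i.succ + MvPowerSeries.C d * MvPowerSeries.X 0 ^ e i from rfl,
        map_add, map_mul, map_pow, MvPowerSeries.substAlgHom_X, MvPowerSeries.substAlgHom_X, this,
        show shr e c i.succ = MvPowerSeries.X i.succ + MvPowerSeries.C c * MvPowerSeries.X 0 ^ e i from rfl,
        show shr e c 0 = MvPowerSeries.X 0 from rfl]
      rw [add_assoc, ← add_mul, ← map_add, hcd, map_zero, zero_mul, add_zero]
  rw [MvPowerSeries.substAlgHom_apply, this, MvPowerSeries.subst_self]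
  rfl

noncomputable def shrEquiv (e : Fin n → ℕ) (he : ∀ i, e i ≠ 0) (c : K) :
    MvPowerSeries (Fin (n + 1)) K ≃ₐ[K] MvPowerSeries (Fin (n + 1)) K :=
  AlgEquiv.ofAlgHom (MvPowerSeries.substAlgHom (shr_hasSubst e he c))
    (MvPowerSeries.substAlgHom (shr_hasSubst e he (-c)))
    (by ext1 f; exact shr_comp e he c (-c) (by simp) f) (by ext1 f; exact shr_comp e he (-c) c (by simp) f)

lemma polSub_X (i : Fin n) : (MvPowerSeries.X i : MvPowerSeries (Fin n) K) ∈ polSub K n :=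
  ⟨MvPolynomial.X i, by simp⟩

lemma polSub_C (a : K) : (MvPowerSeries.C a : MvPowerSeries (Fin n) K) ∈ polSub K n :=
  ⟨MvPolynomial.C a, by simp⟩

lemma polSub_induction {O : Type*} [CommRing O] (f : MvPowerSeries (Fin n) K →+* O) (T : Subring O)
    (hC : ∀ a, f (MvPowerSeries.C a) ∈ T) (hX : ∀ i, f (MvPowerSeries.X i) ∈ T) : ∀ x ∈ polSub K n, f x ∈ T := by
  rintro x ⟨p, rfl⟩
  induction p using MvPolynomial.induction_on with
  | C a => simpa using hC a
  | add p q hp hq => rw [map_add, map_add]; exact add_mem hp hq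
  | mul_X p i hp => rw [map_mul, map_mul]; exact mul_mem hp (by simpa using hX i)

lemma shrEquiv_mem (e : Fin n → ℕ) (he : ∀ i, e i ≠ 0) (c : K) : ∀ f ∈ polSub K (n+1),
    shrEquiv e he c f ∈ polSub K (n+1) := by
  refine polSub_induction (shrEquiv e he c).toAlgHom.toRingHom _ ?_ ?_
  · intro a
    have : (shrEquiv e he c) (MvPowerSeries.C a) = MvPowerSeries.C a := (shrEquiv e he c).commutes a
    simpa [this] using polSub_C a
  · intro i
    have : (shrEquiv e he c) (MvPowerSeries.X i) = shr e c i := MvPowerSeries.substAlgHom_X (shr_hasSubst e he _) _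
    change (shrEquiv e he c) (MvPowerSeries.X i) ∈ _
    rw [this]
    refine Fin.cases ?_ (fun i => ?_) i
    · exact polSub_X 0
    · exact add_mem (polSub_X _) (mul_mem (polSub_C _) (pow_mem (polSub_X _) _))

lemma shrEquiv_mem_iff (e : Fin n → ℕ) (he : ∀ i, e i ≠ 0) (c : K) (f : MvPowerSeries (Fin (n+1)) K) :
    shrEquiv e he c f ∈ polSub K (n+1) ↔ f ∈ polSub K (n+1) := by
  refine ⟨fun h => ?_, shrEquiv_mem e he c f⟩
  have := shrEquiv_mem e he (-c) _ h
  rwa [show shrEquiv e he (-c) (shrEquiv e he c f) = f from shr_comp e he (-c) c (by simp) f] at this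

lemma finSucc_mem_iff (f : MvPowerSeries (Fin (n+1)) K) :
    f ∈ polSub K (n+1) ↔ MvPowerSeries.finSuccEquiv K n f ∈
      (algebraMap (polSub K n)[X] (PowerSeries (MvPowerSeries (Fin n) K))).range := by
  have hC' : ∀ a ∈ polSub K n, PowerSeries.C a ∈ 
      (algebraMap (polSub K n)[X] (PowerSeries (MvPowerSeries (Fin n) K))).range := fun a ha =>
    ⟨C ⟨a, ha⟩, by simp [PowerSeries.algebraMap_apply', subring_algebraMap]⟩
  constructor
  · revert f
    refine polSub_induction (MvPowerSeries.finSuccEquiv K n).toAlgHom.toRingHom _ ?_ ?_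
    · intro a
      simpa [MvPowerSeries.finSuccEquiv_C] using hC' _ (polSub_C a)
    · intro i
      refine Fin.cases ?_ (fun i => ?_) i
      · exact ⟨X, by simp [PowerSeries.algebraMap_apply', MvPowerSeries.finSuccEquiv_X_zero]⟩
      · simpa [MvPowerSeries.finSuccEquiv_X_succ] using hC' _ (polSub_X i)
  · rintro ⟨p, hp⟩
    have : (MvPowerSeries.finSuccEquiv K n).symm (algebraMap (polSub K n)[X] (PowerSeries (MvPowerSeries (Fin n) K)) p)
      ∈ polSub K (n+1) := by
      clear hp
      induction p using Polynomial.induction_on' with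
      | add p q hp hq => rw [map_add, map_add]; exact add_mem hp hq
      | monomial k a =>
        rw [← C_mul_X_pow_eq_monomial, map_mul, map_mul, map_pow, map_pow]
        refine mul_mem ?_ (pow_mem ?_ _)
        · have : algebraMap (polSub K n)[X] (PowerSeries (MvPowerSeries (Fin n) K)) (C a) = PowerSeries.C (a : MvPowerSeries (Fin n) K) := by
            simp [PowerSeries.algebraMap_apply', subring_algebraMap]
          rw [this]
          refine polSub_induction ((MvPowerSeries.finSuccEquiv K n).symm.toAlgHom.toRingHom.comp PowerSeries.C) _ ?_ ?_ _ a.2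
          · intro b
            change (MvPowerSeries.finSuccEquiv K n).symm (PowerSeries.C (MvPowerSeries.C b)) ∈ _
            rw [← MvPowerSeries.finSuccEquiv_C, AlgEquiv.symm_apply_apply]
            exact polSub_C b
          · intro b
            change (MvPowerSeries.finSuccEquiv K n).symm (PowerSeries.C (MvPowerSeries.X b)) ∈ _
            rw [← MvPowerSeries.finSuccEquiv_X_succ, AlgEquiv.symm_apply_apply]
            exact polSub_X _
        · have : algebraMap (polSub K n)[X] (PowerSeries (MvPowerSeries (Fin n) K)) X = PowerSeries.X := by
            simp [PowerSeries.algebraMap_apply']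
          rw [this, ← MvPowerSeries.finSuccEquiv_X_zero, AlgEquiv.symm_apply_apply]
          exact polSub_X _
    rwa [hp, AlgEquiv.symm_apply_apply] at this

lemma shr_residue (e : Fin n → ℕ) (he : ∀ i, e i ≠ 0) (d : MvPolynomial (Fin (n+1)) K)
    (hd : MvPolynomial.aeval (Fin.cons X (fun i => X ^ e i) : Fin (n + 1) → K[X]) d ≠ 0) :
    (MvPowerSeries.finSuccEquiv K n (shrEquiv e he 1 (MvPolynomial.coeToMvPowerSeries.ringHom d))).map
      (residue (MvPowerSeries (Fin n) K)) ≠ 0 := by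
  let r : K →+* ResidueField (MvPowerSeries (Fin n) K) := (residue (MvPowerSeries (Fin n) K)).comp MvPowerSeries.C
  have key : ((PowerSeries.map (residue (MvPowerSeries (Fin n) K))).comp
      ((MvPowerSeries.finSuccEquiv K n).toAlgHom.toRingHom.comp ((shrEquiv e he (1:K)).toAlgHom.toRingHom.comp
        MvPolynomial.coeToMvPowerSeries.ringHom))) =
      (PowerSeries.map r).comp (Polynomial.coeToPowerSeries.ringHom.comp
        (MvPolynomial.aeval (R := K) (Fin.cons X (fun i => X ^ e i) : Fin (n + 1) → K[X])).toRingHom) := by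
    apply MvPolynomial.ringHom_ext
    · intro a
      have : (shrEquiv e he (1:K)) (MvPowerSeries.C a) = MvPowerSeries.C a := (shrEquiv e he 1).commutes a
      simp [this, MvPowerSeries.finSuccEquiv_C, r]
    · intro i
      have : (shrEquiv e he (1:K)) (MvPowerSeries.X i) = shr e 1 i := MvPowerSeries.substAlgHom_X (shr_hasSubst e he _) _
      change PowerSeries.map (residue (MvPowerSeries (Fin n) K)) (MvPowerSeries.finSuccEquiv K n
        (shrEquiv e he (1:K) (MvPolynomial.X i : MvPolynomial (Fin (n+1)) K))) = PowerSeries.map r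
        ((MvPolynomial.aeval (R := K) (Fin.cons X (fun i => X ^ e i) : Fin (n + 1) → K[X]) (MvPolynomial.X i) : K[X]) : PowerSeries K)
      rw [MvPolynomial.coe_X, this, MvPolynomial.aeval_X]
      refine Fin.cases ?_ (fun i => ?_) i
      · simp [shr, MvPowerSeries.finSuccEquiv_X_zero]
      · have : residue (MvPowerSeries (Fin n) K) (MvPowerSeries.X i) = 0 := by
          rw [residue_eq_zero_iff, mv_mem_maximalIdeal]; simp
        simp [shr, MvPowerSeries.finSuccEquiv_X_zero, MvPowerSeries.finSuccEquiv_X_succ, this]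
  have k2 : _ = PowerSeries.map r
        ((MvPolynomial.aeval (R := K) (Fin.cons X (fun i => X ^ e i) : Fin (n + 1) → K[X]) d : K[X]) : PowerSeries K) :=
    RingHom.congr_fun key d
  intro h0
  replace h0 := k2.symm.trans h0
  apply hd
  ext i
  have := congrArg (PowerSeries.coeff i) h0
  simpa using this

theorem algHens_polSub : ∀ n : ℕ, AlgHens (polSub K n) := by
  intro n
  induction n with
  | zero =>
    intro H hH φ _
    exact hH.le (mem_polSub_of_finite φ (Set.toFinite _))
  | succ n ih =>
    intro H hH φ hφ
    obtain ⟨q, hq0, hq, hq'⟩ := exists_sep φ hφ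
    have halg : IsAlgebraic (polSub K (n+1)) (aeval φ (derivative q)) :=
      Algebra.isAlgebraic_adjoin_singleton_iff.mpr hφ _ (aeval_mem_adjoin_singleton _ _)
    obtain ⟨t, ht, D, hD0, hD⟩ := halg.exists_nonzero_eq_adjoin_mul (mem_nonZeroDivisors_of_ne_zero hq')
    obtain ⟨b, rfl⟩ : ∃ b : (polSub K (n+1))[X], aeval φ b = t := by
      rw [Algebra.adjoin_singleton_eq_range_aeval] at ht
      obtain ⟨b, hb⟩ := ht
      refine ⟨b.comp (derivative q), ?_⟩
      rw [aeval_comp]; exact hb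
    obtain ⟨d, hd⟩ : ∃ d : MvPolynomial (Fin (n+1)) K, MvPolynomial.coeToMvPowerSeries.ringHom d = (D : MvPowerSeries (Fin (n+1)) K) := D.2
    have hd0 : d ≠ 0 := by
      rintro rfl
      apply hD0
      apply Subtype.ext
      rw [← hd, map_zero]; rfl
    have : IsDomain (MvPowerSeries (Fin n) K) := NoZeroDivisors.to_isDomain _
    obtain ⟨e, he, hed⟩ := exists_shift d hd0
    refine key_step' (polSub K n) ih
      (((shrEquiv e he (1:K)).trans (MvPowerSeries.finSuccEquiv K n)) : MvPowerSeries (Fin (n+1)) K ≃+* PowerSeries (MvPowerSeries (Fin n) K))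
      (polSub K (n+1)) ?_ H hH φ q b D hq0 hq ?_ ?_
    · intro x
      rw [← shrEquiv_mem_iff e he 1, finSucc_mem_iff]; rfl
    · rw [mul_comm, hD]; rfl
    · rw [← hd]
      exact shr_residue e he d hed

end CoordSec


section FracSec
set_option linter.unusedSectionVars false
open Polynomial IsLocalRing

variable {R : Type*} [CommRing R] {D : Type*} [CommRing D]

/-- closed under inverses -/
def InvC (T : Subring R) : Prop := ∀ x ∈ T, ∀ y, x * y = 1 → y ∈ T

/-- fractions of elements of the range of `ψ` -/
def fracSub (ψ : D →+* R) : Subring R where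
  carrier := {x | ∃ p q, IsUnit (ψ q) ∧ x * ψ q = ψ p}
  mul_mem' := by
    rintro x y ⟨p, q, hq, h⟩ ⟨p', q', hq', h'⟩
    refine ⟨p * p', q * q', by rw [map_mul]; exact hq.mul hq', ?_⟩
    rw [map_mul, map_mul, ← h, ← h']; ring
  one_mem' := ⟨1, 1, by simp, by simp⟩
  add_mem' := by
    rintro x y ⟨p, q, hq, h⟩ ⟨p', q', hq', h'⟩
    refine ⟨p * q' + p' * q, q * q', by rw [map_mul]; exact hq.mul hq', ?_⟩
    rw [map_mul, map_add, map_mul, map_mul, ← h, ← h']; ring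
  zero_mem' := ⟨0, 1, by simp, by simp⟩
  neg_mem' := by
    rintro x ⟨p, q, hq, h⟩
    exact ⟨-p, q, hq, by rw [map_neg, ← h]; ring⟩

lemma fracSub_invC (ψ : D →+* R) : InvC (fracSub ψ) := by
  rintro x ⟨p, q, hq, h⟩ y hxy
  refine ⟨q, p, ?_, ?_⟩
  · rw [← h]; exact (IsUnit.of_mul_eq_one y hxy).mul hq
  · rw [← h, ← mul_assoc, mul_comm y, hxy, one_mul]

lemma fracSub_map_mem (ψ : D →+* R) (p : D) : ψ p ∈ fracSub ψ := ⟨p, 1, by simp, by simp⟩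

lemma fracSub_le (ψ : D →+* R) (T : Subring R) (hT : InvC T) (h : ∀ p, ψ p ∈ T) : fracSub ψ ≤ T := by
  rintro x ⟨p, q, hq, hx⟩
  obtain ⟨v, hv⟩ := hq.exists_right_inv
  have : x = ψ p * v := by rw [← hx, mul_assoc, hv, mul_one]
  rw [this]
  exact mul_mem (h p) (hT _ (h q) _ hv)

lemma fracSub_ideal (ψ : D →+* R) (I J : Ideal (fracSub ψ))
    (h : ∀ p, (⟨ψ p, fracSub_map_mem ψ p⟩ : fracSub ψ) ∈ I → (⟨ψ p, fracSub_map_mem ψ p⟩ : fracSub ψ) ∈ J) :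
    I ≤ J := by
  rintro ⟨x, p, q, hq, hx⟩ hI
  obtain ⟨v, hv⟩ := hq.exists_right_inv
  have hvm := fracSub_invC ψ _ (fracSub_map_mem ψ q) _ hv
  have e1 : (⟨ψ p, fracSub_map_mem ψ p⟩ : fracSub ψ) = ⟨ψ q, fracSub_map_mem ψ q⟩ * ⟨x, p, q, hq, hx⟩ :=
    Subtype.ext (by change ψ p = ψ q * x; rw [← hx, mul_comm])
  have e2 : (⟨x, p, q, hq, hx⟩ : fracSub ψ) = ⟨v, hvm⟩ * ⟨ψ p, fracSub_map_mem ψ p⟩ := 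
    Subtype.ext (by change x = v * ψ p; rw [← hx]; linear_combination (-x) * hv)
  rw [e2]
  apply Ideal.mul_mem_left
  apply h
  rw [e1]
  exact Ideal.mul_mem_left _ _ hI

/-- the map to fractions -/
def toFrac (ψ : D →+* R) : D →+* fracSub ψ := ψ.codRestrict _ (fracSub_map_mem ψ)

lemma fracSub_noeth (ψ : D →+* R) [IsNoetherianRing D] : IsNoetherianRing (fracSub ψ) := by
  rw [isNoetherianRing_iff_ideal_fg]
  intro I
  have : I = (I.comap (toFrac ψ)).map (toFrac ψ) := by
    apply le_antisymm
    · apply fracSub_ideal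
      intro p hp
      exact Ideal.mem_map_of_mem (toFrac ψ) (show p ∈ I.comap (toFrac ψ) from hp)
    · exact Ideal.map_comap_le
  rw [this]
  exact ((isNoetherianRing_iff_ideal_fg _).1 ‹_› _).map _

/-- contraction of the maximal ideal -/
def mS [IsLocalRing R] (S : Subring R) : Ideal S := (maximalIdeal R).comap S.subtype

lemma mem_mS [IsLocalRing R] (S : Subring R) (s : S) : s ∈ mS S ↔ (s : R) ∈ maximalIdeal R := Iff.rfl

/-- order condition -/
def OrdC [IsLocalRing R] (S : Subring R) : Prop :=
  ∀ (k : ℕ) (s : S), (s : R) ∈ maximalIdeal R ^ k → s ∈ mS S ^ k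

lemma fracSub_ord [IsLocalRing R] (ψ : D →+* R) (J : Ideal D) (hJ : ∀ p ∈ J, ψ p = 0)
    (h : ∀ k p, ψ p ∈ maximalIdeal R ^ k → p ∈ ((maximalIdeal R).comap ψ) ^ k ⊔ J) : OrdC (fracSub ψ) := by
  intro k
  suffices H : (maximalIdeal R ^ k).comap (fracSub ψ).subtype ≤ mS (fracSub ψ) ^ k from fun s hs => H hs
  apply fracSub_ideal
  intro p hp
  have := h k p hp
  obtain ⟨y, hy, z, hz, rfl⟩ := Submodule.mem_sup.1 this
  have e : (⟨ψ (y + z), fracSub_map_mem ψ _⟩ : fracSub ψ) = toFrac ψ y :=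
    Subtype.ext (by change ψ (y + z) = ψ y; rw [map_add, hJ z hz, add_zero])
  rw [e]
  have h1 : ((maximalIdeal R).comap ψ).map (toFrac ψ) ≤ mS (fracSub ψ) := by
    rw [Ideal.map_le_iff_le_comap]
    intro x hx; exact hx
  have h2 := Ideal.mem_map_of_mem (toFrac ψ) hy
  rw [Ideal.map_pow] at h2
  exact Ideal.pow_right_mono h1 k h2

lemma frac_lift {B : Type*} [CommRing B] (ψ : D →+* R) (η : D →+* B) (hker : ∀ p, ψ p = 0 → η p = 0)
    (hunit : ∀ q, IsUnit (ψ q) → IsUnit (η q)) :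
    ∃ h : fracSub ψ →+* B, ∀ (x : fracSub ψ) p q, IsUnit (ψ q) → x * ψ q = ψ p → h x * η q = η p := by
  have key : ∀ (x : R) p q p' q', IsUnit (ψ q) → x * ψ q = ψ p → IsUnit (ψ q') → x * ψ q' = ψ p' →
      η p * η q' = η p' * η q := by
    intro x p q p' q' _ h _ h'
    have : ψ (p * q' - p' * q) = 0 := by
      rw [map_sub, map_mul, map_mul, ← h, ← h']; ring
    have := hker _ this
    rwa [map_sub, map_mul, map_mul, sub_eq_zero] at this
  choose p q hq hx using fun x : fracSub ψ => x.2
  choose v hv using fun x : fracSub ψ => (hunit _ (hq x)).exists_right_inv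
  have main : ∀ (x : fracSub ψ) p' q', IsUnit (ψ q') → x * ψ q' = ψ p' → (η (p x) * v x) * η q' = η p' := by
    intro x p' q' h1 h2
    have := key x _ _ _ _ (hq x) (hx x) h1 h2
    linear_combination (v x) * this + (η p') * hv x
  have main' : ∀ (x : fracSub ψ) (b : B) p' q', IsUnit (ψ q') → x * ψ q' = ψ p' → b * η q' = η p' →
      (η (p x) * v x) = b := by
    intro x b p' q' h1 h2 h3
    exact (hunit _ h1).mul_right_cancel ((main x p' q' h1 h2).trans h3.symm)
  have hcan : ∀ x : fracSub ψ, (η (p x) * v x) * η (q x) = η (p x) := fun x => main x _ _ (hq x) (hx x)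
  refine ⟨{ toFun := fun x => η (p x) * v x, map_one' := ?_, map_zero' := ?_, map_mul' := ?_, map_add' := ?_ }, main⟩
  · exact main' 1 1 1 1 (by simp) (by simp) (by simp)
  · intro x y
    refine main' _ _ (p x * p y) (q x * q y) (by rw [map_mul]; exact (hq x).mul (hq y)) ?_ ?_
    · rw [map_mul, map_mul, ← hx, ← hx]; change (x : R) * y * _ = _; ring
    · rw [map_mul, map_mul]; linear_combination (η (p y) * v y * η (q y)) * hcan x + η (p x) * hcan y
  · exact main' 0 0 0 1 (by simp) (by simp) (by simp)
  · intro x y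
    refine main' _ _ (p x * q y + p y * q x) (q x * q y) (by rw [map_mul]; exact (hq x).mul (hq y)) ?_ ?_
    · rw [map_mul, map_add, map_mul, map_mul, ← hx, ← hx]; change ((x : R) + y) * _ = _; ring
    · rw [map_mul, map_add, map_mul, map_mul]
      linear_combination (η (q y)) * hcan x + η (q x) * hcan y

lemma frac_uniq {B : Type*} [CommRing B] (ψ : D →+* R) (h1 h2 : fracSub ψ →+* B)
    (h : ∀ p, h1 (toFrac ψ p) = h2 (toFrac ψ p)) : h1 = h2 := by
  ext x
  obtain ⟨p, q, hq, hx⟩ := x.2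
  have hu : IsUnit (toFrac ψ q) := by
    obtain ⟨v, hv⟩ := hq.exists_right_inv
    exact IsUnit.of_mul_eq_one ⟨v, fracSub_invC ψ _ (fracSub_map_mem ψ q) _ hv⟩ (Subtype.ext hv)
  have e : x * toFrac ψ q = toFrac ψ p := Subtype.ext hx
  apply (hu.map h1).mul_right_cancel
  rw [← map_mul, e, h, h, ← map_mul, e]

end FracSec


section StepSec
set_option linter.unusedSectionVars false
open Polynomial IsLocalRing

variable {R : Type*} [CommRing R] [IsLocalRing R]

/-- evaluation at `t` -/
noncomputable def psi (S : Subring R) (t : R) : S[X] →+* R := eval₂RingHom (algebraMap S R) t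

lemma psi_eq (S : Subring R) (t : R) (p : S[X]) : psi S t p = aeval t p := rfl
lemma psi_C (S : Subring R) (t : R) (s : S) : psi S t (C s) = s := by
  rw [psi_eq, aeval_C]; rfl
lemma psi_X (S : Subring R) (t : R) : psi S t X = t := by
  rw [psi_eq, aeval_X]

lemma psi_sub_mem (S : Subring R) (t : R) (s : S) (hs : t - s ∈ maximalIdeal R) (p : S[X]) :
    psi S t p - (p.eval s : S) ∈ maximalIdeal R := by
  obtain ⟨c, hc⟩ := X_sub_C_dvd_sub_C_eval (a := s) (p := p)
  have := congrArg (psi S t) hc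
  rw [map_sub, map_mul, map_sub, psi_C, psi_C, psi_X] at this
  rw [this]
  exact Ideal.mul_mem_right _ _ hs

lemma isUnit_of_sub_mem {x y : R} (hx : IsUnit x) (h : x - y ∈ maximalIdeal R) : IsUnit y := by
  by_contra hy
  have := add_mem h (show y ∈ maximalIdeal R from hy)
  rw [sub_add_cancel] at this
  exact this hx

lemma newton (S : Subring R) (hinv : InvC S) (hres : ∀ t : R, ∃ s : S, t - s ∈ maximalIdeal R)
    (f : S[X]) (t : R) (hf : aeval t f = 0) (hf' : IsUnit (aeval t (derivative f))) (k : ℕ) :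
    ∃ s : S, t - s ∈ maximalIdeal R ∧
      X - C s ∈ ((maximalIdeal R).comap (psi S t)) ^ (k + 1) ⊔ Ideal.span {f} := by
  induction k with
  | zero =>
    obtain ⟨s, hs⟩ := hres t
    refine ⟨s, hs, Ideal.mem_sup_left ?_⟩
    rw [zero_add, pow_one, Ideal.mem_comap, map_sub, psi_C, psi_X]
    exact hs
  | succ k ih =>
    obtain ⟨s, hs, hX⟩ := ih
    have h1 : IsUnit (((derivative f).eval s : S) : R) :=
      isUnit_of_sub_mem hf' (psi_sub_mem S t s hs (derivative f))
    obtain ⟨v', hv'⟩ := h1.exists_right_inv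
    obtain ⟨v, rfl⟩ : ∃ v : S, (v : R) = v' := ⟨⟨v', hinv _ (Subtype.prop _) _ hv'⟩, rfl⟩
    have hv : (derivative f).eval s * v = 1 := Subtype.ext hv'
    have h2 : ((f.eval s : S) : R) ∈ maximalIdeal R := by
      have := psi_sub_mem S t s hs f
      rw [psi_eq, hf, zero_sub] at this
      exact neg_mem_iff.1 this
    obtain ⟨c, hc⟩ := exists_mul_sq_add_linear_part_eq_eval_add (f.map C) (C s) (X - C s)
    rw [add_sub_cancel, derivative_map, eval_map, eval_map, eval_map, eval₂_C_X,
      eval₂_hom, eval₂_hom] at hc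
    change c * (X - C s) ^ 2 + C (eval s (derivative f)) * (X - C s) + C (eval s f) = f at hc
    have hvC : C ((derivative f).eval s) * C v = 1 := by rw [← C_mul, hv, C_1]
    refine ⟨s - v * f.eval s, ?_, ?_⟩
    · have : t - ((s - v * f.eval s : S) : R) = (t - s) + v * (f.eval s : S) := by
        push_cast; ring
      rw [this]
      exact add_mem hs (Ideal.mul_mem_left _ _ h2)
    · have : X - C (s - v * f.eval s) = C v * f - (C v * c) * ((X - C s) * (X - C s)) := by
        rw [C_sub, C_mul]
        linear_combination (C v) * hc - (X - C s) * hvC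
      rw [this]
      refine sub_mem (Ideal.mem_sup_right (Ideal.mul_mem_left _ _ (Ideal.mem_span_singleton_self f)))
        (Ideal.mul_mem_left _ _ ?_)
      have hn : X - C s ∈ (maximalIdeal R).comap (psi S t) := by
        rw [Ideal.mem_comap, map_sub, psi_C, psi_X]
        exact hs
      have := Ideal.mul_mem_mul hn hX
      rw [Ideal.mul_sup, ← pow_succ'] at this
      have h0 : (maximalIdeal R).comap (psi S t) * Ideal.span {f} ≤ Ideal.span {f} := Ideal.mul_le_right
      exact (sup_le_sup (le_refl (((maximalIdeal R).comap (psi S t)) ^ (k + 1 + 1))) h0) this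

lemma step_mem (S : Subring R) (hinv : InvC S) (hord : OrdC S) (hres : ∀ t : R, ∃ s : S, t - s ∈ maximalIdeal R)
    (f : S[X]) (t : R) (hf : aeval t f = 0) (hf' : IsUnit (aeval t (derivative f))) (k : ℕ) (p : S[X])
    (hp : psi S t p ∈ maximalIdeal R ^ k) :
    p ∈ ((maximalIdeal R).comap (psi S t)) ^ k ⊔ Ideal.span {f} := by
  obtain ⟨s, hs, hX⟩ := newton S hinv hres f t hf hf' k
  set n := (maximalIdeal R).comap (psi S t) with hn
  have hX' : X - C s ∈ n ^ k ⊔ Ideal.span {f} := by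
    have h0 : n ^ (k + 1) ≤ n ^ k := Ideal.pow_le_pow_right (Nat.le_succ k)
    exact (sup_le_sup h0 (le_refl (Ideal.span {f}))) hX
  have h1 : p - C (p.eval s) ∈ n ^ k ⊔ Ideal.span {f} :=
    Ideal.mem_of_dvd _ X_sub_C_dvd_sub_C_eval hX'
  have h2 : n ^ k ⊔ Ideal.span {f} ≤ (maximalIdeal R ^ k).comap (psi S t) := by
    apply sup_le
    · exact Ideal.le_comap_pow _ k
    · rw [Ideal.span_singleton_le_iff_mem, Ideal.mem_comap, psi_eq, hf]; exact zero_mem _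
  have h3 := h2 h1
  rw [Ideal.mem_comap, map_sub, psi_C] at h3
  have h4 : ((p.eval s : S) : R) ∈ maximalIdeal R ^ k := by
    have := sub_mem hp h3
    rwa [sub_sub_cancel] at this
  have h5 := Ideal.mem_map_of_mem (C : S →+* S[X]) (hord k _ h4)
  rw [Ideal.map_pow] at h5
  have h6 : (mS S).map (C : S →+* S[X]) ≤ n := by
    rw [Ideal.map_le_iff_le_comap]
    intro x hx
    rw [Ideal.mem_comap, hn, Ideal.mem_comap, psi_C]
    exact hx
  have := add_mem h1 (Ideal.mem_sup_left (Ideal.pow_right_mono h6 k h5))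
  rwa [sub_add_cancel] at this

lemma step_ker (S : Subring R) [IsNoetherianRing S] (hinv : InvC S) (hord : OrdC S)
    (hres : ∀ t : R, ∃ s : S, t - s ∈ maximalIdeal R)
    (f : S[X]) (t : R) (hf : aeval t f = 0) (hf' : IsUnit (aeval t (derivative f))) (p : S[X])
    (hp : psi S t p = 0) :
    ∃ r, psi S t r ∈ maximalIdeal R ∧ f ∣ (1 - r) * p := by
  have h := (Ideal.mem_iInf_smul_pow_eq_bot_iff ((maximalIdeal R).comap (psi S t)) (M := S[X] ⧸ Ideal.span {f})
    (Ideal.Quotient.mk _ p)).1 ?_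
  · obtain ⟨⟨r, hr⟩, h⟩ := h
    refine ⟨r, hr, ?_⟩
    rw [← Ideal.mem_span_singleton, ← Ideal.Quotient.eq_zero_iff_mem, map_mul, map_sub, map_one, sub_mul,
      one_mul, sub_eq_zero]
    exact h.symm
  · rw [Submodule.mem_iInf]
    intro k
    obtain ⟨y, hy, z, hz, rfl⟩ := Submodule.mem_sup.1
      (step_mem S hinv hord hres f t hf hf' k p (by rw [hp]; exact zero_mem _))
    rw [map_add, Ideal.Quotient.eq_zero_iff_mem.2 hz, add_zero]
    have : Ideal.Quotient.mk (Ideal.span {f}) y = y • (1 : S[X] ⧸ Ideal.span {f}) := by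
      exact congrArg (Ideal.Quotient.mk (Ideal.span {f})) (mul_one y).symm
    rw [this]
    exact Submodule.smul_mem_smul hy Submodule.mem_top

/-- compatible homomorphisms -/
def Compat {B : Type*} [CommRing B] [IsLocalRing B] (P : Subring R) (g : P →+* B) (S : Subring R)
    (h : S →+* B) : Prop :=
  (∀ x (hx : x ∈ P) (hs : x ∈ S), h ⟨x, hs⟩ = g ⟨x, hx⟩) ∧ ∀ s, s ∈ mS S → h s ∈ maximalIdeal B

lemma step_ex {B : Type*} [CommRing B] [HenselianLocalRing B] (P : Subring R) (g : P →+* B)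
    (S : Subring R) (hPS : P ≤ S) [IsNoetherianRing S] (hinv : InvC S) (hord : OrdC S)
    (hres : ∀ t : R, ∃ s : S, t - s ∈ maximalIdeal R)
    (f : S[X]) (t : R) (hfm : f.Monic) (hf : aeval t f = 0) (hf' : IsUnit (aeval t (derivative f)))
    (h : S →+* B) (hh : Compat P g S h) : ∃ h' : fracSub (psi S t) →+* B, Compat P g _ h' := by
  obtain ⟨s, hs⟩ := hres t
  have hunitS : ∀ x : S, IsUnit (x : R) → IsUnit x := by
    intro x hx
    obtain ⟨v, hv⟩ := hx.exists_right_inv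
    exact IsUnit.of_mul_eq_one ⟨v, hinv _ x.2 _ hv⟩ (Subtype.ext hv)
  have e1 : ∀ p : S[X], (p.map h).eval (h s) = h (p.eval s) := fun p => by
    rw [eval_map, eval₂_hom]
  obtain ⟨a, ha, has⟩ := HenselianLocalRing.is_henselian (f.map h) (hfm.map h) (h s) (by
      rw [e1]
      apply hh.2
      rw [mem_mS]
      have := psi_sub_mem S t s hs f
      rw [psi_eq, hf, zero_sub] at this
      exact neg_mem_iff.1 this) (by
      rw [derivative_map, e1]
      exact (hunitS _ (isUnit_of_sub_mem hf' (psi_sub_mem S t s hs (derivative f)))).map h)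
  let η : S[X] →+* B := eval₂RingHom h a
  have hη : ∀ p, η p = (p.map h).eval a := fun p => by rw [eval_map]; rfl
  have hηs : ∀ p : S[X], η p - h (p.eval s) ∈ maximalIdeal B := by
    intro p
    rw [hη, ← e1]
    exact Ideal.mem_of_dvd _ (sub_dvd_eval_sub _ _ _) has
  have hηm : ∀ p : S[X], psi S t p ∈ maximalIdeal R → η p ∈ maximalIdeal B := by
    intro p hp
    have h1 : p.eval s ∈ mS S := by
      have := sub_mem hp (psi_sub_mem S t s hs p)
      rwa [sub_sub_cancel] at this
    have := add_mem (hηs p) (hh.2 _ h1)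
    rwa [sub_add_cancel] at this
  have hηu : ∀ p : S[X], IsUnit (psi S t p) → IsUnit (η p) := by
    intro p hp
    have h1 := (hunitS _ (isUnit_of_sub_mem hp (psi_sub_mem S t s hs p))).map h
    refine isUnit_of_sub_mem h1 ?_
    rw [← neg_mem_iff, neg_sub]
    exact hηs p
  obtain ⟨h', hh'⟩ := frac_lift (psi S t) η (by
    intro p hp
    obtain ⟨r, hr, c, hc⟩ := step_ker S hinv hord hres f t hf hf' p hp
    have h1 := congrArg η hc
    rw [map_mul, map_mul, hη f, ha.eq_zero, zero_mul, map_sub, map_one] at h1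
    have h2 : IsUnit (1 - η r) := isUnit_of_sub_mem (isUnit_one) (by rw [sub_sub_cancel]; exact hηm r hr)
    exact (h2.mul_right_eq_zero).1 h1) hηu
  refine ⟨h', ?_, ?_⟩
  · intro x hx hs
    have := hh' ⟨x, hs⟩ (C ⟨x, hPS hx⟩) 1 (by simp) (by rw [map_one, mul_one, psi_C])
    rw [map_one, mul_one] at this
    rw [this, ← hh.1 x hx (hPS hx)]
    exact eval₂_C _ _
  · intro x hx
    obtain ⟨p, q, hq, hpq⟩ := x.2
    have h1 := hh' x p q hq hpq
    have h2 : η p ∈ maximalIdeal B := by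
      apply hηm
      rw [← hpq]
      exact Ideal.mul_mem_right _ _ hx
    rw [← h1] at h2
    exact (Ideal.unit_mul_mem_iff_mem _ (hηu q hq)).1 (by rwa [mul_comm])

lemma le_fracSub (S : Subring R) (t : R) : S ≤ fracSub (psi S t) := fun x hx => by
  have := fracSub_map_mem (psi S t) (C ⟨x, hx⟩)
  rwa [psi_C] at this

lemma t_mem_fracSub (S : Subring R) (t : R) : t ∈ fracSub (psi S t) := by
  have := fracSub_map_mem (psi S t) X
  rwa [psi_X] at this

lemma step_uniq {B : Type*} [CommRing B] [IsLocalRing B] (P : Subring R) (g : P →+* B)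
    (S : Subring R)
    (hres : ∀ t : R, ∃ s : S, t - s ∈ maximalIdeal R)
    (f : S[X]) (t : R) (hf : aeval t f = 0) (hf' : IsUnit (aeval t (derivative f)))
    (huniq : ∀ h1 h2 : S →+* B, Compat P g S h1 → Compat P g S h2 → h1 = h2)
    (h1 h2 : fracSub (psi S t) →+* B) (hh1 : Compat P g _ h1) (hh2 : Compat P g _ h2) : h1 = h2 := by
  set ι : S →+* fracSub (psi S t) := Subring.inclusion (le_fracSub S t) with hι
  set T : fracSub (psi S t) := ⟨t, t_mem_fracSub S t⟩ with hT
  have hcomp : ∀ h : fracSub (psi S t) →+* B, Compat P g _ h → Compat P g S (h.comp ι) := by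
    intro h hh
    refine ⟨fun x hx hs => hh.1 x hx _, fun s hs => hh.2 _ hs⟩
  have e := huniq _ _ (hcomp h1 hh1) (hcomp h2 hh2)
  have hfr : ∀ p : S[X], toFrac (psi S t) p = (p.map ι).eval T := by
    intro p
    apply Subtype.ext
    change psi S t p = (fracSub (psi S t)).subtype _
    rw [eval_map, hom_eval₂]
    rfl
  have hev : ∀ (h : fracSub (psi S t) →+* B) (p : S[X]), h (toFrac (psi S t) p) = (p.map (h.comp ι)).eval (h T) := by
    intro h p
    rw [hfr, eval_map, hom_eval₂, eval_map]
  have hT : h1 T = h2 T := by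
    have hf0 : toFrac (psi S t) f = 0 := Subtype.ext hf
    refine IsLocalRing.eq_of_eval_eq_zero_of_not_isUnit_sub (f := f.map (h1.comp ι)) ?_ ?_ ?_ ?_
    · rw [← hev, hf0, map_zero]
    · rw [e, ← hev, hf0, map_zero]
    · obtain ⟨s, hs⟩ := hres t
      have a1 := hh1.2 (T - ι s) hs
      have a2 := hh2.2 (T - ι s) hs
      have a3 : h1 (ι s) = h2 (ι s) := RingHom.congr_fun e s
      have : h1 T - h2 T = h1 (T - ι s) - h2 (T - ι s) := by
        rw [map_sub, map_sub, a3]; ring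
      rw [this]
      exact sub_mem a1 a2
    · rw [derivative_map, ← hev]
      apply IsUnit.map
      obtain ⟨v, hv⟩ := hf'.exists_right_inv
      exact IsUnit.of_mul_eq_one ⟨v, fracSub_invC _ _ (fracSub_map_mem (psi S t) (derivative f)) _ hv⟩ (Subtype.ext hv)
  apply frac_uniq
  intro p
  rw [hev, hev, e, hT]

end StepSec


section GlueSec
set_option linter.unusedSectionVars false
open Polynomial IsLocalRing

variable {R : Type*} [CommRing R]

/-- smallest inverse-closed subring containing `P` and `F` -/
def cl (P : Subring R) (F : Set R) : Subring R := sInf {T | P ≤ T ∧ F ⊆ T ∧ InvC T}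

lemma cl_le {P : Subring R} {F : Set R} {T : Subring R} (h1 : P ≤ T) (h2 : F ⊆ T) (h3 : InvC T) : cl P F ≤ T :=
  sInf_le ⟨h1, h2, h3⟩

lemma le_cl (P : Subring R) (F : Set R) : P ≤ cl P F := le_sInf fun _ h => h.1

lemma subset_cl (P : Subring R) (F : Set R) : F ⊆ cl P F := fun x hx => by
  rw [SetLike.mem_coe, cl, Subring.mem_sInf]
  exact fun T hT => hT.2.1 hx

lemma cl_invC (P : Subring R) (F : Set R) : InvC (cl P F) := by
  intro x hx y hxy
  rw [cl, Subring.mem_sInf] at hx ⊢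
  exact fun T hT => hT.2.2 x (hx T hT) y hxy

lemma cl_mono {P : Subring R} {F F' : Set R} (h : F ⊆ F') : cl P F ≤ cl P F' :=
  cl_le (le_cl _ _) (h.trans (subset_cl _ _)) (cl_invC _ _)

lemma cl_insert [IsLocalRing R] (P : Subring R) (F : Set R) (t : R) : cl P (insert t F) = fracSub (psi (cl P F) t) := by
  apply le_antisymm
  · refine cl_le ((le_cl P F).trans (le_fracSub _ _)) ?_ (fracSub_invC _)
    rintro x (rfl | hx)
    · exact t_mem_fracSub _ _
    · exact le_fracSub _ _ (subset_cl P F hx)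
  · refine fracSub_le _ _ (cl_invC _ _) fun p => ?_
    have h1 : cl P F ≤ cl P (insert t F) := cl_mono (Set.subset_insert _ _)
    have h2 : t ∈ cl P (insert t F) := subset_cl _ _ (Set.mem_insert _ _)
    induction p using Polynomial.induction_on' with
    | add p q hp hq => rw [map_add]; exact add_mem hp hq
    | monomial k a =>
      rw [← C_mul_X_pow_eq_monomial, map_mul, map_pow, psi_C, psi_X]
      exact mul_mem (h1 a.2) (pow_mem h2 _)

lemma cl_alg [IsDomain R] {P : Subring R} {F : Set R} (hF : ∀ x ∈ F, IsAlgebraic P x) :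
    ∀ x ∈ cl P F, IsAlgebraic P x := by
  suffices h : cl P F ≤ (Subalgebra.algebraicClosure P R).toSubring from fun x hx => h hx
  refine cl_le ?_ hF ?_
  · intro x hx
    exact isAlgebraic_algebraMap (⟨x, hx⟩ : P)
  · intro x hx y hxy
    change IsAlgebraic P y
    have hx' : IsAlgebraic P x := hx
    refine isAlgebraic_of_root (C x * X + C (-1)) ?_ ?_ y ?_
    · intro h
      have := congrArg (fun f => f.coeff 0) h
      simp at this
    · intro i
      have h1 : ∀ k : ℕ, IsAlgebraic P ((X : R[X]).coeff k) := by
        intro k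
        rw [coeff_X]
        split_ifs
        · exact isAlgebraic_one
        · exact isAlgebraic_zero
      have h2 : ∀ k : ℕ, IsAlgebraic P ((C (-1) : R[X]).coeff k) := by
        intro k
        rw [coeff_C]
        split_ifs
        · exact isAlgebraic_one.neg
        · exact isAlgebraic_zero
      rw [coeff_add, coeff_C_mul]
      exact (hx'.mul (h1 _)).add (h2 _)
    · simp [hxy]

variable [IsLocalRing R] {B : Type*} [CommRing B] [HenselianLocalRing B]

/-- good subrings -/
structure GoodS (P : Subring R) (g : P →+* B) (S : Subring R) : Prop where
  noeth : IsNoetherianRing S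
  ord : OrdC S
  ex : ∃ h : S →+* B, Compat P g S h
  uniq : ∀ h1 h2 : S →+* B, Compat P g S h1 → Compat P g S h2 → h1 = h2

/-- good finite sets -/
structure Good (P : Subring R) (g : P →+* B) (F : Set R) : Prop where
  fin : F.Finite
  alg : ∀ x ∈ F, IsAlgebraic P x
  good : GoodS P g (cl P F)

lemma good_step [IsDomain R] {P : Subring R} {g : P →+* B} (hres : ∀ t : R, ∃ s : P, t - s ∈ maximalIdeal R)
    {F : Set R} (hF : Good P g F) (f : (cl P F)[X]) (t : R) (hfm : f.Monic) (hf : aeval t f = 0)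
    (hf' : IsUnit (aeval t (derivative f))) : Good P g (insert t F) := by
  have hres' : ∀ t : R, ∃ s : cl P F, t - s ∈ maximalIdeal R := fun t => by
    obtain ⟨s, hs⟩ := hres t
    exact ⟨⟨s, le_cl P F s.2⟩, hs⟩
  refine ⟨hF.fin.insert t, ?_, ?_⟩
  · rintro x (rfl | hx)
    · refine isAlgebraic_of_root (f.map (algebraMap (cl P F) R)) (hfm.map _).ne_zero (fun i => ?_) x ?_
      · rw [coeff_map]
        exact cl_alg hF.alg _ (f.coeff i).2
      · rw [eval_map]; exact hf
    · exact hF.alg x hx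
  · rw [cl_insert]
    have hn := hF.good.noeth
    obtain ⟨h, hh⟩ := hF.good.ex
    refine ⟨fracSub_noeth _, ?_, ?_, ?_⟩
    · refine fracSub_ord _ (Ideal.span {f}) ?_ ?_
      · intro p hp
        obtain ⟨c, rfl⟩ := Ideal.mem_span_singleton.1 hp
        rw [map_mul, psi_eq, hf, zero_mul]
      · exact step_mem _ (cl_invC _ _) hF.good.ord hres' f t hf hf'
    · exact step_ex P g _ (le_cl _ _) (cl_invC _ _) hF.good.ord hres' f t hfm hf hf' h hh
    · exact step_uniq P g _ hres' f t hf hf' hF.good.uniq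

/-- absorbable elements -/
def absSub (P : Subring R) (g : P →+* B) : Subring R where
  carrier := {x | ∀ F, Good P g F → ∃ F', Good P g F' ∧ F ⊆ F' ∧ x ∈ cl P F'}
  mul_mem' := by
    intro x y hx hy F hF
    obtain ⟨F1, h1, h2, h3⟩ := hx F hF
    obtain ⟨F2, h4, h5, h6⟩ := hy F1 h1
    exact ⟨F2, h4, h2.trans h5, mul_mem (cl_mono h5 h3) h6⟩
  add_mem' := by
    intro x y hx hy F hF
    obtain ⟨F1, h1, h2, h3⟩ := hx F hF
    obtain ⟨F2, h4, h5, h6⟩ := hy F1 h1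
    exact ⟨F2, h4, h2.trans h5, add_mem (cl_mono h5 h3) h6⟩
  one_mem' := fun F hF => ⟨F, hF, subset_rfl, one_mem _⟩
  zero_mem' := fun F hF => ⟨F, hF, subset_rfl, zero_mem _⟩
  neg_mem' := by
    intro x hx F hF
    obtain ⟨F1, h1, h2, h3⟩ := hx F hF
    exact ⟨F1, h1, h2, neg_mem h3⟩

lemma absSub_finite (P : Subring R) (g : P →+* B) (I : Set R) (hI : I.Finite) (hIs : I ⊆ absSub P g)
    (F : Set R) (hF : Good P g F) : ∃ F', Good P g F' ∧ F ⊆ F' ∧ I ⊆ cl P F' := by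
  induction I, hI using Set.Finite.induction_on with
  | empty => exact ⟨F, hF, subset_rfl, Set.empty_subset _⟩
  | insert _ _ ih =>
    obtain ⟨F1, h1, h2, h3⟩ := ih ((Set.subset_insert _ _).trans hIs)
    obtain ⟨F2, h4, h5, h6⟩ := hIs (Set.mem_insert _ _) F1 h1
    refine ⟨F2, h4, h2.trans h5, ?_⟩
    rintro x (rfl | hx)
    · exact h6
    · exact cl_mono h5 (h3 hx)

lemma absSub_hclosed [IsDomain R] (P : Subring R) (g : P →+* B)
    (hres : ∀ t : R, ∃ s : P, t - s ∈ maximalIdeal R) : HClosed P (absSub P g) := by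
  refine ⟨?_, ?_, ?_⟩
  · intro x hx F hF
    exact ⟨F, hF, subset_rfl, le_cl P F hx⟩
  · intro x hx y hxy F hF
    obtain ⟨F1, h1, h2, h3⟩ := hx F hF
    exact ⟨F1, h1, h2, cl_invC _ _ x h3 y hxy⟩
  · intro f t hfm hf hf' F hF
    set f1 : R[X] := f.map (absSub P g).subtype with hf1
    obtain ⟨F1, h1, h2, h3⟩ := absSub_finite P g (f1.coeffs : Set R) (Finset.finite_toSet _) (by
      intro x hx
      obtain ⟨i, _, rfl⟩ := Polynomial.mem_coeffs_iff.1 hx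
      rw [hf1, coeff_map]
      exact (f.coeff i).2) F hF
    set f2 := f1.toSubring (cl P F1) h3 with hf2
    have hmap : f2.map (cl P F1).subtype = f.map (absSub P g).subtype := map_toSubring _ _ _
    have e : ∀ p : (cl P F1)[X], aeval t p = (p.map (cl P F1).subtype).eval t := fun p => by
      rw [eval_map]; rfl
    have e' : ∀ p : (absSub P g)[X], aeval t p = (p.map (absSub P g).subtype).eval t := fun p => by
      rw [eval_map]; rfl
    refine ⟨insert t F1, good_step hres h1 f2 t ?_ ?_ ?_, h2.trans (Set.subset_insert _ _),
      subset_cl _ _ (Set.mem_insert _ _)⟩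
    · rw [hf2, monic_toSubring]; exact hfm.map _
    · rw [e, hmap, ← e', hf]
    · rw [e, ← derivative_map, hmap, derivative_map, ← e']; exact hf'

theorem glue [IsDomain R] (P : Subring R) (g : P →+* B) (hP : AlgHens P)
    (hres : ∀ t : R, ∃ s : P, t - s ∈ maximalIdeal R) (h0 : Good P g ∅)
    (A : Subring R) (hA : ∀ x, x ∈ A ↔ IsAlgebraic P x) : ∃! h : A →+* B, Compat P g A h := by
  have habs : ∀ x, IsAlgebraic P x → x ∈ absSub P g := fun x hx => hP _ (absSub_hclosed P g hres) x hx
  have hclA : ∀ F, Good P g F → cl P F ≤ A := fun F hF x hx => (hA x).2 (cl_alg hF.alg x hx)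
  have hrestr : ∀ (S T : Subring R) (hST : S ≤ T) (h : T →+* B), Compat P g T h →
      Compat P g S (h.comp (Subring.inclusion hST)) := fun S T hST h hh =>
    ⟨fun x hx hs => hh.1 x hx _, fun s hs => hh.2 _ hs⟩
  choose hh hhc using fun F : {F // Good P g F} => F.2.good.ex
  have hcomp : ∀ (F F' : {F // Good P g F}) (hl : cl P F.1 ≤ cl P F'.1) (x : R) (hx : x ∈ cl P F.1),
      hh F ⟨x, hx⟩ = hh F' ⟨x, hl hx⟩ := by
    intro F F' hl x hx
    have := F.2.good.uniq _ _ (hhc F) (hrestr _ _ hl _ (hhc F'))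
    exact RingHom.congr_fun this ⟨x, hx⟩
  have hdir : ∀ F F' : {F // Good P g F}, ∃ F'' : {F // Good P g F}, cl P F.1 ≤ cl P F''.1 ∧ cl P F'.1 ≤ cl P F''.1 := by
    intro F F'
    obtain ⟨F2, h1, h2, h3⟩ := absSub_finite P g F'.1 F'.2.fin (fun x hx => habs x (F'.2.alg x hx)) F.1 F.2
    exact ⟨⟨F2, h1⟩, cl_mono h2, cl_le (le_cl _ _) h3 (cl_invC _ _)⟩
  have hex : ∀ a : A, ∃ F : {F // Good P g F}, (a : R) ∈ cl P F.1 := by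
    intro a
    obtain ⟨F, h1, _, h3⟩ := habs a ((hA a).1 a.2) ∅ h0
    exact ⟨⟨F, h1⟩, h3⟩
  choose Fa hFa using hex
  let φ : A → B := fun a => hh (Fa a) ⟨a, hFa a⟩
  have hφ : ∀ (a : A) (F : {F // Good P g F}) (ha : (a : R) ∈ cl P F.1), φ a = hh F ⟨a, ha⟩ := by
    intro a F ha
    obtain ⟨F2, h1, h2⟩ := hdir (Fa a) F
    change hh (Fa a) ⟨a, hFa a⟩ = _
    rw [hcomp _ F2 h1 _ (hFa a), hcomp _ F2 h2 _ ha]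
  have hpair : ∀ a b : A, ∃ F : {F // Good P g F}, (a : R) ∈ cl P F.1 ∧ (b : R) ∈ cl P F.1 := by
    intro a b
    obtain ⟨F2, h1, h2⟩ := hdir (Fa a) (Fa b)
    exact ⟨F2, h1 (hFa a), h2 (hFa b)⟩
  let Φ : A →+* B :=
    { toFun := φ
      map_one' := by
        rw [hφ 1 (Fa 1) (one_mem _)]; exact map_one (hh (Fa 1))
      map_zero' := by
        rw [hφ 0 (Fa 0) (zero_mem _)]; exact map_zero (hh (Fa 0))
      map_mul' := by
        intro a b
        obtain ⟨F, h1, h2⟩ := hpair a b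
        rw [hφ a F h1, hφ b F h2, hφ (a * b) F (mul_mem h1 h2), ← map_mul]; rfl
      map_add' := by
        intro a b
        obtain ⟨F, h1, h2⟩ := hpair a b
        rw [hφ a F h1, hφ b F h2, hφ (a + b) F (add_mem h1 h2), ← map_add]; rfl }
  refine ⟨Φ, ⟨?_, ?_⟩, ?_⟩
  · intro x hx hs
    exact (hhc (Fa ⟨x, hs⟩)).1 x hx _
  · intro s hs
    exact (hhc (Fa s)).2 _ hs
  · intro Ψ hΨ
    ext a
    have := (Fa a).2.good.uniq _ _ (hrestr _ _ (hclA _ (Fa a).2) _ hΨ) (hhc (Fa a))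
    exact RingHom.congr_fun this ⟨a, hFa a⟩

end GlueSec


section FinalSec
set_option linter.unusedSectionVars false
open IsLocalRing

variable {K : Type*} [Field K] {n : ℕ}

lemma coe_constantCoeff (q : MvPolynomial (Fin n) K) :
    MvPowerSeries.constantCoeff (MvPolynomial.coeToMvPowerSeries.ringHom q) = MvPolynomial.constantCoeff q := by
  rw [MvPolynomial.coeToMvPowerSeries.ringHom_apply, ← MvPowerSeries.coeff_zero_eq_constantCoeff_apply,
    MvPolynomial.coeff_coe]
  rfl

lemma coe_isUnit (q : MvPolynomial (Fin n) K) :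
    IsUnit (MvPolynomial.coeToMvPowerSeries.ringHom q : MvPowerSeries (Fin n) K) ↔ MvPolynomial.constantCoeff q ≠ 0 := by
  rw [← coe_constantCoeff, ne_eq, ← mv_not_isUnit_iff, not_not]

lemma coe_mem_max (q : MvPolynomial (Fin n) K) :
    (MvPolynomial.coeToMvPowerSeries.ringHom q : MvPowerSeries (Fin n) K) ∈ maximalIdeal (MvPowerSeries (Fin n) K)
      ↔ MvPolynomial.constantCoeff q = 0 := by
  rw [← coe_constantCoeff, mv_mem_maximalIdeal]

lemma coe_inj : Function.Injective
    (MvPolynomial.coeToMvPowerSeries.ringHom : MvPolynomial (Fin n) K →+* MvPowerSeries (Fin n) K) :=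
  MvPolynomial.coe_injective _ _

lemma mem_max_pow (k : ℕ) : ∀ f ∈ maximalIdeal (MvPowerSeries (Fin n) K) ^ k, (k : ℕ∞) ≤ MvPowerSeries.order f := by
  induction k with
  | zero => intro f _; simp
  | succ k ih =>
    intro f hf
    rw [pow_succ] at hf
    induction hf using Submodule.mul_induction_on' with
    | mem_mul_mem a ha b hb =>
      refine le_trans ?_ MvPowerSeries.le_order_mul
      push_cast
      refine add_le_add (ih a ha) ?_
      exact MvPowerSeries.one_le_order_iff_constCoeff_eq_zero.2 ((mv_mem_maximalIdeal b).1 hb)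
    | add a _ b _ h1 h2 => exact le_trans (le_min h1 h2) MvPowerSeries.min_order_le_add

lemma mem_vars_iff (q : MvPolynomial (Fin n) K) :
    q ∈ Ideal.span (Set.range (MvPolynomial.X : Fin n → MvPolynomial (Fin n) K)) ↔ MvPolynomial.constantCoeff q = 0 := by
  have := MvPolynomial.mem_pow_idealOfVars_iff' 1 q
  rw [pow_one] at this
  change q ∈ MvPolynomial.idealOfVars (Fin n) K ↔ _
  rw [this]
  constructor
  · intro h
    exact h 0 (by simp)
  · intro h x hx
    have : x = 0 := by
      rw [Nat.lt_one_iff] at hx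
      exact (Finsupp.degree_eq_zero_iff x).1 hx
    rw [this]; exact h

lemma coe_ord : OrdC (fracSub
    (MvPolynomial.coeToMvPowerSeries.ringHom : MvPolynomial (Fin n) K →+* MvPowerSeries (Fin n) K)) := by
  refine fracSub_ord _ ⊥ (by simp) fun k p hp => Ideal.mem_sup_left ?_
  have h1 := mem_max_pow k _ hp
  have h2 : p ∈ MvPolynomial.idealOfVars (Fin n) K ^ k := by
    rw [MvPolynomial.mem_pow_idealOfVars_iff']
    intro x hx
    rw [← MvPolynomial.coeff_coe]
    apply MvPowerSeries.coeff_of_lt_order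
    exact lt_of_lt_of_le (by exact_mod_cast hx) h1
  refine Ideal.pow_right_mono ?_ k h2
  intro q hq
  exact (coe_mem_max q).2 ((mem_vars_iff q).1 hq)

lemma cl_empty : cl (polSub K n) ∅ = fracSub
    (MvPolynomial.coeToMvPowerSeries.ringHom : MvPolynomial (Fin n) K →+* MvPowerSeries (Fin n) K) := by
  apply le_antisymm
  · refine cl_le ?_ (Set.empty_subset _) (fracSub_invC _)
    rintro _ ⟨p, rfl⟩
    exact fracSub_map_mem _ p
  · exact fracSub_le _ _ (cl_invC _ _) fun p => le_cl _ _ ⟨p, rfl⟩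

lemma base_good {B : Type*} [CommRing B] [HenselianLocalRing B] (η : MvPolynomial (Fin n) K →+* B)
    (h1 : ∀ q, MvPolynomial.constantCoeff q ≠ 0 → IsUnit (η q))
    (h0 : ∀ q, MvPolynomial.constantCoeff q = 0 → η q ∈ maximalIdeal B)
    (g : polSub K n →+* B)
    (hg : ∀ q (hq : MvPolynomial.coeToMvPowerSeries.ringHom q ∈ polSub K n),
      g ⟨MvPolynomial.coeToMvPowerSeries.ringHom q, hq⟩ = η q) : Good (polSub K n) g ∅ := by
  refine ⟨Set.finite_empty, by simp, ?_⟩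
  rw [cl_empty]
  refine ⟨fracSub_noeth _, coe_ord, ?_, ?_⟩
  · obtain ⟨h, hh⟩ := frac_lift (MvPolynomial.coeToMvPowerSeries.ringHom :
      MvPolynomial (Fin n) K →+* MvPowerSeries (Fin n) K) η
      (fun p hp => by rw [coe_inj (hp.trans (map_zero _).symm), map_zero])
      (fun q hq => h1 q ((coe_isUnit q).1 hq))
    refine ⟨h, ?_, ?_⟩
    · rintro _ ⟨p, rfl⟩ hs
      have := hh ⟨_, hs⟩ p 1 (by simp) (by simp)
      rw [map_one, mul_one] at this
      exact this.trans (hg p _).symm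
    · intro s hs
      obtain ⟨p, q, hq, hx⟩ := s.2
      have h2 := hh s p q hq hx
      have h3 : MvPolynomial.coeToMvPowerSeries.ringHom p ∈ maximalIdeal (MvPowerSeries (Fin n) K) := by
        rw [← hx]; exact Ideal.mul_mem_right _ _ hs
      have h4 := h0 p ((coe_mem_max p).1 h3)
      rw [← h2] at h4
      exact (Ideal.mul_unit_mem_iff_mem _ (h1 q ((coe_isUnit q).1 hq))).1 h4
  · intro a b ha hb
    apply frac_uniq
    intro p
    exact (ha.1 _ ⟨p, rfl⟩ (fracSub_map_mem _ p)).trans (hb.1 _ ⟨p, rfl⟩ (fracSub_map_mem _ p)).symm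

/-- polynomials as a subring of power series -/
noncomputable def polEquiv (K : Type*) [Field K] (n : ℕ) : MvPolynomial (Fin n) K ≃+* polSub K n :=
  RingEquiv.ofBijective (MvPolynomial.coeToMvPowerSeries.ringHom : MvPolynomial (Fin n) K →+*
    MvPowerSeries (Fin n) K).rangeRestrict
    ⟨fun a b h => coe_inj (congrArg Subtype.val h), RingHom.rangeRestrict_surjective _⟩

lemma polEquiv_coe (q : MvPolynomial (Fin n) K) :
    ((polEquiv K n q : polSub K n) : MvPowerSeries (Fin n) K) = MvPolynomial.coeToMvPowerSeries.ringHom q := rfl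

lemma isAlg_iff (φ : MvPowerSeries (Fin n) K) : IsAlgebraicMvPowerSeries φ ↔ IsAlgebraic (polSub K n) φ := by
  have e1 : (algebraMap (polSub K n) (MvPowerSeries (Fin n) K)).comp (polEquiv K n).toRingHom =
    MvPolynomial.coeToMvPowerSeries.ringHom := rfl
  have e2 : (MvPolynomial.coeToMvPowerSeries.ringHom).comp (polEquiv K n).symm.toRingHom =
    algebraMap (polSub K n) (MvPowerSeries (Fin n) K) := by
    rw [← e1]; ext x; simp
  constructor
  · rintro ⟨q, hq, h⟩
    refine ⟨q.map (polEquiv K n).toRingHom, ?_, ?_⟩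
    · exact (Polynomial.map_ne_zero_iff (polEquiv K n).injective).2 hq
    · rw [Polynomial.aeval_def, Polynomial.eval₂_map, e1, h]
  · rintro ⟨q, hq, h⟩
    refine ⟨q.map (polEquiv K n).symm.toRingHom, ?_, ?_⟩
    · exact (Polynomial.map_ne_zero_iff (polEquiv K n).symm.injective).2 hq
    · rw [Polynomial.eval₂_map, e2]; exact h

lemma alg_henselian [IsDomain (MvPowerSeries (Fin n) K)] (A : Subring (MvPowerSeries (Fin n) K))
    (hA : ∀ x, x ∈ A ↔ IsAlgebraic (polSub K n) x) :
    IsLocalHom A.subtype ∧ HenselianLocalRing A := by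
  have hloc : IsLocalHom A.subtype := by
    constructor
    intro a ha
    obtain ⟨b, hb⟩ := ha.exists_right_inv
    have hF : ∀ x ∈ (A : Set (MvPowerSeries (Fin n) K)), IsAlgebraic (polSub K n) x := fun x hx => (hA x).1 hx
    have hbA : b ∈ A := (hA b).2 (cl_alg hF b (cl_invC _ _ _ (subset_cl _ _ a.2) b hb))
    exact IsUnit.of_mul_eq_one ⟨b, hbA⟩ (Subtype.ext hb)
  haveI := hloc
  haveI : IsLocalRing A := RingHom.domain_isLocalRing A.subtype
  refine ⟨hloc, ⟨?_⟩⟩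
  intro f hf a₀ h1 h2
  have key := HenselianRing.is_henselian (I := maximalIdeal (MvPowerSeries (Fin n) K)) (f.map A.subtype)
    (hf.map _) (a₀ : MvPowerSeries (Fin n) K) ?_ ?_
  · obtain ⟨a, ha, hm⟩ := key
    have haA : a ∈ A := by
      refine (hA a).2 (isAlgebraic_of_root (f.map A.subtype) (hf.map _).ne_zero (fun i => ?_) a ha)
      rw [Polynomial.coeff_map]
      exact (hA _).1 (f.coeff i).2
    refine ⟨⟨a, haA⟩, ?_, ?_⟩
    · apply Subtype.val_injective
      have : Polynomial.eval (A.subtype ⟨a, haA⟩) (f.map A.subtype) = 0 := ha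
      rw [Polynomial.eval_map_apply] at this
      exact this
    · intro hu
      exact hm (hu.map A.subtype)
  · change Polynomial.eval (A.subtype a₀) (f.map A.subtype) ∈ _
    rw [Polynomial.eval_map_apply]
    intro hu
    exact h1 (isUnit_of_map_unit A.subtype _ hu)
  · change IsUnit (Ideal.Quotient.mk _ (Polynomial.eval (A.subtype a₀) (Polynomial.derivative (f.map A.subtype))))
    rw [Polynomial.derivative_map, Polynomial.eval_map_apply]
    exact (h2.map A.subtype).map _

end FinalSec


/-- The ring of algebraic power series `K[[X]]_alg`, together with the natural map from
`K[X]_{(X₁,…,Xₙ)}`, satisfies the universal property of (i.e. is isomorphic as a local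
`K[X]_{(X)}`-algebra to) the henselization of the localization of the polynomial ring at
the maximal ideal generated by the variables: it is Henselian local, the structure map is
a local homomorphism, and every local homomorphism to a Henselian local ring factors
through it uniquely. -/
theorem algebraic_power_series_is_henselization
    {K : Type*} [Field K] {n : ℕ}
    (A : Subring (MvPowerSeries (Fin n) K))
    (hA : ∀ φ, φ ∈ A ↔ IsAlgebraicMvPowerSeries φ)
    (P : Ideal (MvPolynomial (Fin n) K))
    (hP : P = Ideal.span (Set.range MvPolynomial.X)) [P.IsPrime]
    (ρ : Localization.AtPrime P →+* ↥A)
    (hρ : ∀ q : MvPolynomial (Fin n) K,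
      ((ρ (algebraMap (MvPolynomial (Fin n) K) (Localization.AtPrime P) q) :
          MvPowerSeries (Fin n) K)
        = MvPolynomial.coeToMvPowerSeries.ringHom q)) :
    HenselianLocalRing ↥A ∧ IsLocalHom ρ ∧
    ∀ (B : Type) (_ : CommRing B) (_ : HenselianLocalRing B)
      (g : Localization.AtPrime P →+* B), IsLocalHom g →
      ∃! h : ↥A →+* B, IsLocalHom h ∧ h.comp ρ = g := by
  have hdom : IsDomain (MvPowerSeries (Fin n) K) := NoZeroDivisors.to_isDomain _
  have hA' : ∀ x, x ∈ A ↔ IsAlgebraic (polSub K n) x := fun x => (hA x).trans (isAlg_iff x)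
  obtain ⟨hloc, hhens⟩ := alg_henselian A hA'
  have hmem : ∀ q, q ∈ P ↔ MvPolynomial.constantCoeff q = 0 := fun q => by rw [hP, mem_vars_iff]
  have hu : ∀ q, MvPolynomial.constantCoeff q ≠ 0 →
      IsUnit (algebraMap (MvPolynomial (Fin n) K) (Localization.AtPrime P) q) := fun q hq =>
    (IsLocalization.AtPrime.isUnit_to_map_iff (Localization.AtPrime P) P q).2 fun h => hq ((hmem q).1 h)
  have hnu : ∀ q, MvPolynomial.constantCoeff q = 0 →
      ¬ IsUnit (algebraMap (MvPolynomial (Fin n) K) (Localization.AtPrime P) q) := fun q hq h =>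
    (IsLocalization.AtPrime.isUnit_to_map_iff (Localization.AtPrime P) P q).1 h ((hmem q).2 hq)
  refine ⟨hhens, ?_, ?_⟩
  · constructor
    intro x hx
    obtain ⟨⟨p, s⟩, hs⟩ := IsLocalization.surj P.primeCompl x
    have hsu : IsUnit (algebraMap (MvPolynomial (Fin n) K) (Localization.AtPrime P) s) :=
      IsLocalization.map_units _ s
    have h1 : IsUnit (ρ (algebraMap _ (Localization.AtPrime P) p)) := by
      rw [← hs, map_mul]
      exact hx.mul (hsu.map ρ)
    have h2 := h1.map A.subtype
    rw [Subring.subtype_apply, hρ, coe_isUnit] at h2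
    have h3 := hu p h2
    rw [← hs] at h3
    exact isUnit_of_mul_isUnit_left h3
  · intro B _ _ g hg
    let η : MvPolynomial (Fin n) K →+* B := g.comp (algebraMap _ _)
    let g' : polSub K n →+* B := η.comp (polEquiv K n).symm.toRingHom
    have hg' : ∀ q (hq : MvPolynomial.coeToMvPowerSeries.ringHom q ∈ polSub K n),
        g' ⟨MvPolynomial.coeToMvPowerSeries.ringHom q, hq⟩ = η q := by
      intro q hq
      have : (⟨MvPolynomial.coeToMvPowerSeries.ringHom q, hq⟩ : polSub K n) = polEquiv K n q := rfl
      rw [this]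
      change η ((polEquiv K n).symm (polEquiv K n q)) = η q
      rw [RingEquiv.symm_apply_apply]
    have hbase : Good (polSub K n) g' ∅ := base_good η (fun q hq => (hu q hq).map g)
      (fun q hq => fun h => hnu q hq (isUnit_of_map_unit g _ h)) g' hg'
    have hres : ∀ t : MvPowerSeries (Fin n) K, ∃ s : polSub K n,
        t - s ∈ IsLocalRing.maximalIdeal (MvPowerSeries (Fin n) K) := fun t =>
      ⟨⟨MvPowerSeries.C (MvPowerSeries.constantCoeff t), polSub_C _⟩, by
        rw [mv_mem_maximalIdeal]; simp⟩
    have key := glue (polSub K n) g' (algHens_polSub n) hres hbase A hA'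
    have hiff : ∀ h : A →+* B, (IsLocalHom h ∧ h.comp ρ = g) ↔ Compat (polSub K n) g' A h := by
      intro h
      constructor
      · rintro ⟨hl, hc⟩
        constructor
        · rintro _ ⟨q, rfl⟩ hs
          refine Eq.trans ?_ (hg' q _).symm
          change _ = g _
          rw [← hc, RingHom.comp_apply]
          congr 1
          exact Subtype.ext (hρ q).symm
        · intro s hs hn
          exact hs ((isUnit_of_map_unit h _ hn).map A.subtype)
      · rintro ⟨hc, hm⟩
        constructor
        · constructor
          intro a ha
          by_contra hn
          refine hm a ?_ ha
          intro hn'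
          exact hn (isUnit_of_map_unit A.subtype _ hn')
        · apply IsLocalization.ringHom_ext P.primeCompl
          refine RingHom.ext fun q => ?_
          have hq : MvPolynomial.coeToMvPowerSeries.ringHom q ∈ A := hρ q ▸ (ρ _).2
          have h1 := hc _ ⟨q, rfl⟩ hq
          have h2 := h1.trans (hg' q _)
          refine Eq.trans ?_ h2
          change h (ρ _) = _
          congr 1
          exact Subtype.ext (hρ q)
    obtain ⟨h, hh, hun⟩ := key
    exact ⟨h, (hiff h).2 hh, fun h' hh' => hun h' ((hiff h').1 hh')⟩
end

section
/- Let I = (p₁,…,p_s) ⊆ K[X₁,…,Xₙ] be an ideal over a field K with I ⊆ (X), let V = Spec(K[X]/I) have dimension r at the origin, and let M = (∂p_i/∂X_j(0)) be the Jacobian matrix at the origin. Then rank(M) ≤ n − r, and V is smooth at the origin if and only if rank(M) = n − r. -/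
open MvPolynomial IsLocalRing in
lemma jc_taylor {K : Type*} [Field K] {n : ℕ} (f : MvPolynomial (Fin n) K) :
    f - C (eval 0 f) - ∑ j, C (eval 0 (pderiv j f)) * X j
      ∈ (Ideal.span (Set.range (X : Fin n → MvPolynomial (Fin n) K))) ^ 2 := by
  have hX : ∀ i, (X i : MvPolynomial (Fin n) K) ∈
      Ideal.span (Set.range (X : Fin n → MvPolynomial (Fin n) K)) :=
    fun i => Ideal.subset_span ⟨i, rfl⟩
  induction f using MvPolynomial.induction_on with
  | C a => simp
  | add p q hp hq =>
    convert Ideal.add_mem _ hp hq using 1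
    simp only [map_add, add_mul, Finset.sum_add_distrib]
    ring
  | mul_X p i hp =>
    have h1 : ∑ j, C (eval 0 (pderiv j (p * X i))) * X j
        = C (eval 0 p) * (X i : MvPolynomial (Fin n) K) := by
      rw [Finset.sum_eq_single i]
      · simp [pderiv_X]
      · intro j _ hj
        simp [pderiv_X, Pi.single_apply, hj.symm]
      · simp
    rw [h1]
    have : p * X i - C (eval 0 (p * X i)) - C (eval 0 p) * X i
      = (p - C (eval 0 p) - ∑ j, C (eval 0 (pderiv j p)) * X j) * X i
        + (∑ j, C (eval 0 (pderiv j p)) * X j) * X i := by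
      simp; ring
    rw [this]
    refine Ideal.add_mem _ (Ideal.mul_mem_right _ _ hp) ?_
    rw [pow_two]
    refine Ideal.mul_mem_mul (Ideal.sum_mem _ fun j _ => Ideal.mul_mem_left _ _ (hX j)) (hX i)

open MvPolynomial in
lemma jc_mem {K : Type*} [Field K] {n : ℕ} (f : MvPolynomial (Fin n) K) :
    f ∈ Ideal.span (Set.range (X : Fin n → MvPolynomial (Fin n) K)) ↔ eval 0 f = 0 := by
  constructor
  · intro h
    have : Ideal.span (Set.range (X : Fin n → MvPolynomial (Fin n) K)) ≤
        RingHom.ker (eval (0 : Fin n → K)) := by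
      rw [Ideal.span_le]
      rintro _ ⟨i, rfl⟩
      simp [RingHom.mem_ker]
    exact this h
  · intro h
    have h1 := Ideal.pow_le_self (two_ne_zero) (jc_taylor f)
    rw [h] at h1
    simp only [map_zero, sub_zero] at h1
    have := Ideal.add_mem _ h1 (Ideal.sum_mem (t := Finset.univ)
      (f := fun j => C (eval 0 (pderiv j f)) * X j) _ fun j _ =>
      Ideal.mul_mem_left _ _ (Ideal.subset_span ⟨j, rfl⟩))
    simpa using this

open MvPolynomial in
lemma jc_grad_sq {K : Type*} [Field K] {n : ℕ} (f : MvPolynomial (Fin n) K)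
    (hf : f ∈ (Ideal.span (Set.range (X : Fin n → MvPolynomial (Fin n) K))) ^ 2) (j : Fin n) :
    eval 0 (pderiv j f) = 0 := by
  rw [pow_two] at hf
  induction hf using Submodule.mul_induction_on' with
  | mem_mul_mem a ha b hb =>
    rw [jc_mem] at ha hb
    simp only [Derivation.leibniz, map_add, smul_eq_mul, map_mul, ha, hb, zero_mul, add_zero]
  | add a _ b _ ha hb => rw [map_add, map_add, ha, hb, add_zero]

open MvPolynomial in
lemma jc_grad_I {K : Type*} [Field K] {n s : ℕ} (p : Fin s → MvPolynomial (Fin n) K)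
    (hI0 : ∀ i, constantCoeff (p i) = 0) (f : MvPolynomial (Fin n) K)
    (hf : f ∈ Ideal.span (Set.range p)) :
    (fun j => eval 0 (pderiv j f)) ∈ Submodule.span K
      (Set.range fun i j => eval (0 : Fin n → K) (pderiv j (p i))) := by
  obtain ⟨c, rfl⟩ := (Ideal.mem_span_range_iff_exists_fun).1 hf
  have h0 : ∀ i, eval (0 : Fin n → K) (p i) = 0 := fun i => by
    rw [← hI0 i]; simp [constantCoeff_eq]
  have : (fun j => eval (0 : Fin n → K) (pderiv j (∑ i, c i * p i)))
      = ∑ i, eval (0 : Fin n → K) (c i) • (fun j => eval (0 : Fin n → K) (pderiv j (p i))) := by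
    ext j
    simp only [Derivation.leibniz, map_sum, map_add, smul_eq_mul, map_mul, h0, zero_mul, add_zero,
      Finset.sum_apply, Pi.smul_apply]
  rw [this]
  exact Submodule.sum_mem _ fun i _ => Submodule.smul_mem _ _ (Submodule.subset_span ⟨i, rfl⟩)

open MvPolynomial IsLocalRing in
lemma jc_main {K : Type*} [Field K] {n s : ℕ}
    (p : Fin s → MvPolynomial (Fin n) K)
    (I : Ideal (MvPolynomial (Fin n) K)) (hI : I = Ideal.span (Set.range p))
    (hI0 : ∀ i, MvPolynomial.constantCoeff (p i) = 0)
    (mQ : Ideal (MvPolynomial (Fin n) K ⧸ I))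
    (hmQ : mQ = Ideal.map (Ideal.Quotient.mk I) (Ideal.span (Set.range MvPolynomial.X)))
    [mQ.IsPrime]
    (R : Type*) [CommRing R] [IsLocalRing R] [Algebra (MvPolynomial (Fin n) K ⧸ I) R] [Algebra K R]
    [IsScalarTower K (MvPolynomial (Fin n) K ⧸ I) R] [IsLocalization.AtPrime R mQ]
    (M : Matrix (Fin s) (Fin n) K)
    (hM : M = fun i j => MvPolynomial.eval (0 : Fin n → K) (MvPolynomial.pderiv j (p i))) :
    (maximalIdeal R).spanFinrank + M.rank = n := by
  let Q := MvPolynomial (Fin n) K ⧸ I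
  let mA := Ideal.span (Set.range (X : Fin n → MvPolynomial (Fin n) K))
  let g : MvPolynomial (Fin n) K →ₐ[K] R :=
    (IsScalarTower.toAlgHom K Q R).comp (Ideal.Quotient.mkₐ K I)
  have gdef : ∀ f, g f = algebraMap Q R (Ideal.Quotient.mk I f) := fun f => rfl
  have hIle : I ≤ mA := by
    rw [hI, Ideal.span_le]
    rintro _ ⟨i, rfl⟩
    refine (jc_mem _).2 ?_
    rw [← hI0 i]; simp [constantCoeff_eq]
  have hmk : ∀ f, Ideal.Quotient.mk I f ∈ mQ ↔ eval 0 f = 0 := by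
    intro f
    rw [← jc_mem, hmQ, ← Ideal.mem_comap,
      Ideal.comap_map_of_surjective _ Ideal.Quotient.mk_surjective,
      ← RingHom.ker_eq_comap_bot, Ideal.mk_ker, sup_eq_left.2 hIle]
  have hmax : maximalIdeal R = mA.map g.toRingHom := by
    rw [← IsLocalization.AtPrime.map_eq_maximalIdeal mQ R]
    have := Ideal.map_map (Ideal.Quotient.mk I) (algebraMap (MvPolynomial (Fin n) K ⧸ I) R) (I := mA)
    rw [← hmQ] at this
    exact this
  have hgm : ∀ f, eval 0 f = 0 → g f ∈ maximalIdeal R := fun f hf => by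
    rw [hmax]; exact Ideal.mem_map_of_mem _ ((jc_mem f).2 hf)
  have hgm2 : ∀ f ∈ mA ^ 2, g f ∈ maximalIdeal R ^ 2 := fun f hf => by
    rw [hmax, ← Ideal.map_pow]; exact Ideal.mem_map_of_mem _ hf
  have hgI : ∀ f ∈ I, g f = 0 := fun f hf => by
    rw [gdef, Ideal.Quotient.eq_zero_iff_mem.2 hf, map_zero]
  -- residue field
  have hres : ∀ x : R, ∃ c : K, x - algebraMap K R c ∈ maximalIdeal R := by
    intro x
    obtain ⟨a, t, rfl⟩ := IsLocalization.exists_mk'_eq mQ.primeCompl x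
    obtain ⟨a, rfl⟩ := Ideal.Quotient.mk_surjective a
    obtain ⟨t, ht⟩ := t
    obtain ⟨t, rfl⟩ := Ideal.Quotient.mk_surjective t
    have ht0 : eval 0 t ≠ 0 := fun h => ht ((hmk t).2 h)
    refine ⟨eval 0 a / eval 0 t, ?_⟩
    have hu : IsUnit (g t) := IsLocalization.map_units R (⟨_, ht⟩ : mQ.primeCompl)
    rw [← Ideal.unit_mul_mem_iff_mem _ hu, mul_sub]
    have h1 : g t * IsLocalization.mk' R (Ideal.Quotient.mk I a) ⟨_, ht⟩ = g a := by
      rw [mul_comm]; exact IsLocalization.mk'_spec R _ _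
    rw [h1, ← g.commutes, ← map_mul, ← map_sub]
    apply hgm
    simp only [algebraMap_eq, map_sub, map_mul, eval_C]
    field_simp
    simp
  have hsurj : Function.Surjective (algebraMap K (ResidueField R)) := by
    intro y
    obtain ⟨x, rfl⟩ := residue_surjective y
    obtain ⟨c, hc⟩ := hres x
    refine ⟨c, ?_⟩
    rw [IsScalarTower.algebraMap_apply K R (ResidueField R)]
    exact ((Ideal.Quotient.mk_eq_mk_iff_sub_mem _ _).2 hc).symm
  have hfr1 : Module.finrank K (ResidueField R) = 1 := by
    have e : K ≃ₐ[K] ResidueField R := AlgEquiv.ofBijective (Algebra.ofId K _)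
      ⟨(algebraMap K (ResidueField R)).injective, hsurj⟩
    rw [← e.toLinearEquiv.finrank_eq, Module.finrank_self]
  have hfin : IsNoetherianRing R := by
    haveI : IsNoetherianRing Q := inferInstance
    exact IsLocalization.isNoetherianRing mQ.primeCompl R this
  have htow : IsScalarTower K (ResidueField R) (CotangentSpace R) := by
    refine IsScalarTower.of_algebraMap_smul fun c z => ?_
    rw [IsScalarTower.algebraMap_apply K R (ResidueField R), algebraMap_smul, algebraMap_smul]
  have hfr : Module.finrank K (CotangentSpace R) =
      Module.finrank (ResidueField R) (CotangentSpace R) := by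
    rw [← Module.finrank_mul_finrank K (ResidueField R) (CotangentSpace R), hfr1, one_mul]
  let φ : (Fin n → K) →ₗ[K] CotangentSpace R :=
    Fintype.linearCombination K (fun j => (maximalIdeal R).toCotangent ⟨g (X j), hgm _ (by simp)⟩)
  have hφ : ∀ a : Fin n → K, φ a = (maximalIdeal R).toCotangent
      ⟨g (∑ j, C (a j) * X j), hgm _ (by simp)⟩ := by
    intro a
    have : (⟨g (∑ j, C (a j) * X j), hgm _ (by simp)⟩ : maximalIdeal R)
        = ∑ j, algebraMap K R (a j) • ⟨g (X j), hgm _ (by simp)⟩ := by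
      ext
      simp only [map_sum, map_mul, AddSubmonoidClass.coe_finsetSum, Submodule.coe_smul, smul_eq_mul]
      refine Finset.sum_congr rfl fun j _ => ?_
      rw [← g.commutes]; rfl
    rw [this, map_sum]
    simp only [map_smul, algebraMap_smul]
    rfl
  have hker : LinearMap.ker φ = Submodule.span K (Set.range M.row) := by
    have hrow : Set.range M.row =
      (Set.range fun i j => eval (0 : Fin n → K) (pderiv j (p i))) := by
      rw [hM]; rfl
    apply le_antisymm
    · intro a ha
      rw [LinearMap.mem_ker, hφ, Ideal.toCotangent_eq_zero] at ha
      simp only at ha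
      rw [hmax, ← Ideal.map_pow] at ha
      have h2 : (mA ^ 2).map g.toRingHom
          = ((mA ^ 2).map (Ideal.Quotient.mk I)).map (algebraMap Q R) := by
        rw [Ideal.map_map]; rfl
      rw [h2, gdef, IsLocalization.algebraMap_mem_map_algebraMap_iff mQ.primeCompl] at ha
      obtain ⟨t, ht, hta⟩ := ha
      obtain ⟨t, rfl⟩ := Ideal.Quotient.mk_surjective t
      have ht0 : eval 0 t ≠ 0 := fun h => ht ((hmk t).2 h)
      rw [← map_mul, ← Ideal.mem_comap,
        Ideal.comap_map_of_surjective _ Ideal.Quotient.mk_surjective,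
        ← RingHom.ker_eq_comap_bot, Ideal.mk_ker] at hta
      obtain ⟨u, hu, v, hv, huv⟩ := Submodule.mem_sup.1 hta
      have hv' := jc_grad_I p hI0 v (hI ▸ hv)
      have : (fun j => eval 0 (pderiv j v)) = eval 0 t • a := by
        ext j
        have := congrArg (fun f => eval (0 : Fin n → K) (pderiv j f)) huv
        simp only [map_add, jc_grad_sq u hu, zero_add] at this
        rw [this]
        simp [Derivation.leibniz, pderiv_X, Pi.single_apply]
      rw [this] at hv'
      rw [hrow]
      exact (Submodule.smul_mem_iff _ ht0).1 hv'
    · rw [Submodule.span_le, hrow]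
      rintro _ ⟨i, rfl⟩
      change φ _ = 0
      rw [hφ, Ideal.toCotangent_eq_zero]
      simp only
      have h0 : eval (0 : Fin n → K) (p i) = 0 := by
        rw [← hI0 i]; simp [constantCoeff_eq]
      have h1 := hgm2 _ (jc_taylor (p i))
      rw [map_sub, h0, hgI] at h1
      · rw [zero_sub] at h1
        exact neg_mem_iff.1 h1
      · rw [hI, map_zero, sub_zero]; exact Ideal.subset_span ⟨i, rfl⟩
  have hφs : Function.Surjective φ := by
    have key : ∀ x : R, ∀ hx : x ∈ maximalIdeal R,
        (maximalIdeal R).toCotangent ⟨x, hx⟩ ∈ LinearMap.range φ := by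
      intro x hx
      have hx' := hx
      rw [hmax] at hx'
      change x ∈ Ideal.map g.toRingHom (Ideal.span _) at hx'
      rw [Ideal.map_span, ← Set.range_comp, Ideal.mem_span_range_iff_exists_fun] at hx'
      obtain ⟨c, hc⟩ := hx'
      choose d hd using fun j => hres (c j)
      refine ⟨d, ?_⟩
      rw [hφ, Ideal.toCotangent_eq]
      simp only
      rw [← hc, map_sum, ← Finset.sum_sub_distrib]
      refine Ideal.sum_mem _ fun j _ => ?_
      have : g (C (d j) * X j) - c j * (g.toRingHom ∘ X) j
          = -((c j - algebraMap K R (d j)) * g (X j)) := by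
        rw [map_mul, ← g.commutes]
        change g (C (d j)) * g (X j) - c j * g (X j) = -((c j - g (C (d j))) * g (X j))
        ring
      rw [this, pow_two]
      exact neg_mem (Ideal.mul_mem_mul (hd j) (hgm _ (by simp)))
    intro y
    obtain ⟨⟨x, hx⟩, rfl⟩ := (maximalIdeal R).toCotangent_surjective y
    exact key x hx
  have hrn := LinearMap.finrank_range_add_finrank_ker φ
  rw [LinearMap.range_eq_top.2 hφs, finrank_top, hker, ← Matrix.rank_eq_finrank_span_row, hfr,
    ← spanFinrank_maximalIdeal_eq_finrank_cotangentSpace] at hrn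
  simpa using hrn


/-- Jacobian criterion for smoothness at the origin: if `I = (p₁,…,p_s) ⊆ (X)` and
`V = Spec K[X]/I` has dimension `r` at the origin, then the Jacobian matrix `M` at the
origin has rank at most `n - r`, and `V` is smooth at the origin (the local ring at the
origin is regular, i.e. its maximal ideal is generated by `r` elements) if and only if
`M` has rank exactly `n - r`. -/
theorem jacobian_criterion_rank
    {K : Type*} [Field K] {n s r : ℕ}
    (p : Fin s → MvPolynomial (Fin n) K)
    (I : Ideal (MvPolynomial (Fin n) K)) (hI : I = Ideal.span (Set.range p))
    (hI0 : ∀ i, MvPolynomial.constantCoeff (p i) = 0)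
    (mQ : Ideal (MvPolynomial (Fin n) K ⧸ I))
    (hmQ : mQ = Ideal.map (Ideal.Quotient.mk I) (Ideal.span (Set.range MvPolynomial.X)))
    [mQ.IsPrime]
    (hdim : ringKrullDim (Localization.AtPrime mQ) = (r : WithBot ℕ∞))
    (M : Matrix (Fin s) (Fin n) K)
    (hM : M = fun i j => MvPolynomial.eval (0 : Fin n → K) (MvPolynomial.pderiv j (p i))) :
    M.rank ≤ n - r ∧
    (M.rank = n - r ↔
      ∃ gens : Finset (Localization.AtPrime mQ), gens.card = r ∧
        Ideal.span (gens : Set (Localization.AtPrime mQ))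
          = IsLocalRing.maximalIdeal (Localization.AtPrime mQ)) := by

  have hmain := jc_main p I hI hI0 mQ hmQ (Localization.AtPrime mQ) M hM
  haveI : IsNoetherianRing (Localization.AtPrime mQ) :=
    IsLocalization.isNoetherianRing mQ.primeCompl _ inferInstance
  have hle := ringKrullDim_le_spanFinrank_maximalIdeal (Localization.AtPrime mQ)
  rw [hdim] at hle
  have hle : r ≤ (IsLocalRing.maximalIdeal (Localization.AtPrime mQ)).spanFinrank := by
    exact_mod_cast hle
  have hfg : (IsLocalRing.maximalIdeal (Localization.AtPrime mQ)).FG :=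
    IsNoetherian.noetherian _
  refine ⟨by omega, fun h => ?_, ?_⟩
  · have her : (IsLocalRing.maximalIdeal (Localization.AtPrime mQ)).spanFinrank = r := by omega
    have hf := Submodule.FG.finite_generators hfg
    refine ⟨hf.toFinset, ?_, ?_⟩
    · rw [← Set.ncard_eq_toFinset_card _ hf, Submodule.FG.generators_ncard hfg, her]
    · rw [Set.Finite.coe_toFinset]
      exact Submodule.span_generators _
  · rintro ⟨gens, hc, hs⟩
    have := Submodule.spanFinrank_span_le_ncard_of_finite (R := Localization.AtPrime mQ)
      gens.finite_toSet
    rw [Set.ncard_coe_finset, hc] at this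
    change (Ideal.span _).spanFinrank ≤ r at this
    rw [hs] at this
    omega
end

section
/- Let I = (p₁,…,p_s) ⊆ K[X₁,…,Xₙ] with I ⊆ (X), suppose V = Spec(K[X]/I) is smooth of dimension r at the origin, and suppose det(∂p_i/∂X_j(0) : i,j = r+1,…,n) ≠ 0. Then the polynomials p_{r+1},…,pₙ generate the localization I·K[X]_{(X₁,…,Xₙ)} of I at the maximal ideal (X₁,…,Xₙ). -/
theorem aux_local_quot {B : Type*} [CommRing B] [IsLocalRing B] (J : Ideal B)
    (hJm : J ≤ IsLocalRing.maximalIdeal B) : IsLocalRing (B ⧸ J) := by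
  have hJt : J ≠ ⊤ := fun h =>
    (IsLocalRing.maximalIdeal.isMaximal B).ne_top (top_le_iff.mp (h ▸ hJm))
  have : Nontrivial (B ⧸ J) := Ideal.Quotient.nontrivial_iff.mpr hJt
  exact IsLocalRing.of_surjective' (Ideal.Quotient.mk J) Ideal.Quotient.mk_surjective

theorem aux_max_quot {B : Type*} [CommRing B] [IsLocalRing B] (J : Ideal B)
    (hJm : J ≤ IsLocalRing.maximalIdeal B) [IsLocalRing (B ⧸ J)] :
    IsLocalRing.maximalIdeal (B ⧸ J) =
      (IsLocalRing.maximalIdeal B).map (Ideal.Quotient.mk J) := by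
  refine (IsLocalRing.eq_maximalIdeal ?_).symm
  refine (Ideal.map_eq_top_or_isMaximal_of_surjective _ Ideal.Quotient.mk_surjective
    (IsLocalRing.maximalIdeal.isMaximal B)).resolve_left ?_
  intro h
  have h2 := congrArg (Ideal.comap (Ideal.Quotient.mk J)) h
  rw [Ideal.comap_map_of_surjective _ Ideal.Quotient.mk_surjective, Ideal.comap_top,
    ← RingHom.ker_eq_comap_bot, Ideal.mk_ker, sup_eq_left.mpr hJm] at h2
  exact (IsLocalRing.maximalIdeal.isMaximal B).ne_top h2

open IsLocalRing in
theorem aux_isDomain_of_gens.{u} (r : ℕ) : ∀ (B : Type u) [CommRing B] [IsLocalRing B]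
    [IsNoetherianRing B] (g : Fin r → B),
    Ideal.span (Set.range g) = maximalIdeal B → (r : WithBot ℕ∞) ≤ ringKrullDim B →
    IsDomain B := by
  induction r with
  | zero =>
    intro B _ _ _ g hg _
    have h0 : maximalIdeal B = ⊥ := by rw [← hg]; simp
    exact (IsLocalRing.isField_iff_maximalIdeal_eq.mpr h0).isDomain
  | succ r ih =>
    intro B _ _ _ g hg hd
    set m := maximalIdeal B with hm
    have hjac : m ≤ Ideal.jacobson ⊥ := by
      rw [IsLocalRing.jacobson_eq_maximalIdeal _ bot_ne_top]
    have hfg : m.FG := IsNoetherian.noetherian m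
    -- find x
    obtain ⟨x, hxm, hx2, hxq⟩ : ∃ x ∈ m, x ∉ m * m ∧ ∀ q ∈ minimalPrimes B, x ∉ q := by
      by_contra! hcon
      let s : Set (Ideal B) := insert (m * m) (minimalPrimes B)
      have hs : s.Finite := (minimalPrimes.finite_of_isNoetherianRing B).insert _
      have key := (Ideal.subset_union_prime_finite (R := B) hs (f := id) (m * m) (m * m)
        (I := m) (by
          intro i hi h1 _
          rcases hi with hi | hi
          · exact absurd hi h1
          · exact hi.1.1)).mp (by
          intro x hx
          simp only [Set.mem_iUnion]
          by_cases h : x ∈ m * m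
          · exact ⟨m * m, Set.mem_insert _ _, h⟩
          · obtain ⟨q, hq, hxq⟩ := hcon x hx h
            exact ⟨q, Set.mem_insert_of_mem _ hq, hxq⟩)
      have hpos : ¬ ringKrullDim B ≤ 0 := by
        intro h
        have := hd.trans h
        norm_cast at this
      obtain ⟨i, hi, hmi⟩ := key
      have hmin : m ∈ minimalPrimes B := by
        rcases hi with hi | hi
        · exfalso
          have hmi' : m ≤ m * m := by rw [← hi]; exact hmi
          have : m = ⊥ := Submodule.eq_bot_of_le_smul_of_le_jacobson_bot m m hfg hmi' hjac
          exact hpos (by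
            have hf := IsLocalRing.isField_iff_maximalIdeal_eq.mpr this
            exact (ringKrullDim_eq_zero_of_isField hf).le)
        · have hip : i.IsPrime := hi.1.1
          have : i = m := le_antisymm (IsLocalRing.le_maximalIdeal hip.ne_top) hmi
          rwa [← this]
      apply hpos
      rw [← IsLocalRing.maximalIdeal_height_eq_ringKrullDim]
      have h0 : (maximalIdeal B).height ≤ (∅ : Finset B).card :=
        Ideal.height_le_card_of_mem_minimalPrimes_span_finset (by
          rw [Finset.coe_empty, Ideal.span_empty]; exact hmin)
      rw [Finset.card_empty] at h0
      exact WithBot.coe_le_coe.mpr h0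
    obtain ⟨a, ha⟩ : ∃ a : Fin (r+1) → B, ∑ i, a i * g i = x := by
      have : x ∈ Ideal.span (Set.range g) := hg ▸ hxm
      rw [Ideal.mem_span_range_iff_exists_fun] at this
      exact this
    have hgm : ∀ i, g i ∈ m := fun i => hg ▸ Ideal.subset_span ⟨i, rfl⟩
    obtain ⟨i, hi⟩ : ∃ i, a i ∉ m := by
      by_contra! h
      apply hx2
      rw [← ha]
      exact Ideal.sum_mem _ fun i _ => Ideal.mul_mem_mul (h i) (hgm i)
    have hu : IsUnit (a i) := by
      by_contra h; exact hi ((IsLocalRing.mem_maximalIdeal _).mpr h)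
    let J := Ideal.span {x}
    have hJm : J ≤ m := (Ideal.span_singleton_le_iff_mem _).mpr hxm
    have hJt : J ≠ ⊤ := fun h => (maximalIdeal.isMaximal B).ne_top (top_le_iff.mp (h ▸ hJm))
    have hloc := aux_local_quot J hJm
    have hmap := aux_max_quot J hJm
    have hdom : IsDomain (B ⧸ J) := by
      refine ih (B ⧸ J) (fun j => Ideal.Quotient.mk J (g (i.succAbove j))) ?_ ?_
      · rw [hmap, ← hm, ← hg, Ideal.map_span]
        apply le_antisymm
        · apply Ideal.span_mono
          rintro _ ⟨j, rfl⟩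
          exact ⟨_, ⟨_, rfl⟩, rfl⟩
        · rw [Ideal.span_le]
          rintro _ ⟨_, ⟨j, rfl⟩, rfl⟩
          rcases Fin.eq_self_or_eq_succAbove i j with rfl | ⟨k, rfl⟩
          · have h1 : Ideal.Quotient.mk J x = 0 :=
              Ideal.Quotient.eq_zero_iff_mem.mpr (Ideal.mem_span_singleton_self x)
            rw [← ha, Fin.sum_univ_succAbove _ j, map_add, map_mul, map_sum] at h1
            have h2 := eq_neg_of_add_eq_zero_left h1
            have h3 : Ideal.Quotient.mk J (a j) * Ideal.Quotient.mk J (g j) ∈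
              Ideal.span (Set.range fun k => Ideal.Quotient.mk J (g (j.succAbove k))) := by
              rw [h2]
              refine neg_mem (Ideal.sum_mem _ fun k _ => ?_)
              rw [map_mul]
              exact Ideal.mul_mem_left _ _ (Ideal.subset_span ⟨k, rfl⟩)
            exact (Ideal.unit_mul_mem_iff_mem _ (hu.map _)).mp h3
          · exact Ideal.subset_span ⟨k, rfl⟩
      · have h1 := ringKrullDim_le_ringKrullDim_quotient_add_card ({x} : Finset B) (by
          intro y hy
          rw [Finset.mem_coe, Finset.mem_singleton] at hy
          subst hy
          rw [Ring.jacobson_eq_sInf_isMaximal]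
          simp only [SetLike.mem_coe, Submodule.mem_sInf]
          intro p hp
          rw [IsLocalRing.eq_maximalIdeal hp]
          exact hxm)
        have h2 := hd.trans h1
        rw [Finset.coe_singleton, Finset.card_singleton] at h2
        push_cast at h2
        change _ ≤ ringKrullDim (B ⧸ J) + 1 at h2
        exact ENat.WithBot.add_le_add_one_right_iff.mp h2
    have hJp : J.IsPrime := (Ideal.Quotient.isDomain_iff_prime J).mp hdom
    obtain ⟨q, hq, hqJ⟩ := Ideal.exists_minimalPrimes_le (I := ⊥) (J := J) bot_le
    have hqp : q.IsPrime := hq.1.1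
    have hq0 : q = ⊥ := by
      refine Submodule.eq_bot_of_le_smul_of_le_jacobson_bot m q (IsNoetherian.noetherian q) ?_ hjac
      intro y hy
      obtain ⟨b, rfl⟩ := Ideal.mem_span_singleton'.mp (hqJ hy)
      have hb : b ∈ q := (hqp.mem_or_mem hy).resolve_right (hxq q hq)
      rw [mul_comm]
      exact Ideal.mul_mem_mul hxm hb
    subst hq0
    exact IsDomain.of_bot_isPrime B

theorem aux_sub_const_mem {K : Type*} [Field K] {n : ℕ} (f : MvPolynomial (Fin n) K) :
    f - MvPolynomial.C (MvPolynomial.constantCoeff f) ∈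
      MvPolynomial.idealOfVars (Fin n) K := by
  rw [← pow_one (MvPolynomial.idealOfVars (Fin n) K), MvPolynomial.mem_pow_idealOfVars_iff']
  intro x hx
  have : x = 0 := by
    rw [← Finsupp.degree_eq_zero_iff]; omega
  subst this
  simp [MvPolynomial.constantCoeff_eq]

theorem aux_linear {K : Type*} [Field K] {n : ℕ} (f : MvPolynomial (Fin n) K) :
    f - MvPolynomial.C (MvPolynomial.constantCoeff f)
      - ∑ j, MvPolynomial.C (MvPolynomial.eval (0 : Fin n → K) (MvPolynomial.pderiv j f)) *
          MvPolynomial.X j ∈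
      MvPolynomial.idealOfVars (Fin n) K * MvPolynomial.idealOfVars (Fin n) K := by
  induction f using MvPolynomial.induction_on with
  | C a => simp
  | add p q hp hq =>
    convert add_mem hp hq using 1
    simp only [map_add, add_mul, Finset.sum_add_distrib]
    ring
  | mul_X p i _ =>
    have h := Ideal.mul_mem_mul (aux_sub_const_mem p)
      (Ideal.subset_span ⟨i, rfl⟩ : MvPolynomial.X i ∈ MvPolynomial.idealOfVars (Fin n) K)
    convert h using 1
    have : ∀ j, MvPolynomial.C (MvPolynomial.eval (0 : Fin n → K)
        (MvPolynomial.pderiv j (p * MvPolynomial.X i))) * MvPolynomial.X j =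
        if j = i then MvPolynomial.C (MvPolynomial.constantCoeff p) * MvPolynomial.X i
          else (0 : MvPolynomial (Fin n) K) := by
      intro j
      split_ifs with hji
      · subst hji
        simp [Derivation.leibniz]
      · simp [Derivation.leibniz, MvPolynomial.pderiv_X, Ne.symm hji]
    simp only [this, Finset.sum_ite_eq', Finset.mem_univ, if_true]
    simp [sub_mul]

open IsLocalRing in
theorem aux_key {A C : Type*} [CommRing A] [CommRing C] [IsLocalRing A] [IsNoetherianRing A]
    {r : ℕ} (J : Ideal A) (g : Fin r → A) (hm : maximalIdeal A = Ideal.span (Set.range g) ⊔ J)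
    (f : A →+* C) (hf : Function.Surjective f) (hJf : J ≤ RingHom.ker f)
    (hC : ringKrullDim C = (r : WithBot ℕ∞)) : RingHom.ker f ≤ J := by
  classical
  have hJm : J ≤ maximalIdeal A := hm ▸ le_sup_right
  have hloc := aux_local_quot J hJm
  have hmap := aux_max_quot J hJm
  let g' : Fin r → A ⧸ J := fun i => Ideal.Quotient.mk J (g i)
  have hg' : Ideal.span (Set.range g') = maximalIdeal (A ⧸ J) := by
    rw [hmap, hm, Ideal.map_sup, Ideal.map_quotient_self, sup_bot_eq, Ideal.map_span]
    congr 1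
    rw [← Set.range_comp]; rfl
  let f' : A ⧸ J →+* C := Ideal.Quotient.lift J f (fun a ha => hJf ha)
  have hf' : Function.Surjective f' := Ideal.Quotient.lift_surjective_of_surjective _ _ hf
  have hd : (r : WithBot ℕ∞) ≤ ringKrullDim (A ⧸ J) :=
    hC ▸ ringKrullDim_le_of_surjective f' hf'
  have hdom := aux_isDomain_of_gens r (A ⧸ J) g' hg' hd
  have hle : ringKrullDim (A ⧸ J) ≤ (r : WithBot ℕ∞) := by
    refine (ringKrullDim_le_spanFinrank_maximalIdeal (A ⧸ J)).trans ?_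
    rw [← hg']
    refine Nat.cast_le.mpr ((Submodule.spanFinrank_span_le_ncard_of_finite
      (Set.finite_range g')).trans ?_)
    rw [← Set.image_univ]
    refine (Set.ncard_image_le Set.finite_univ).trans ?_
    simp [Set.ncard_univ]
  intro a ha
  by_contra haJ
  have h0 : Ideal.Quotient.mk J a ≠ 0 := fun h => haJ (Ideal.Quotient.eq_zero_iff_mem.mp h)
  have h1 := (ringKrullDim_succ_le_of_surjective f' hf' (mem_nonZeroDivisors_of_ne_zero h0)
    ((Ideal.Quotient.lift_mk J f _).trans ha)).trans hle
  rw [hC] at h1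
  norm_cast at h1
  omega

theorem aux_vars_mem {K : Type*} [Field K] {n k : ℕ} (T : Ideal (MvPolynomial (Fin n) K))
    (hT : MvPolynomial.idealOfVars (Fin n) K * MvPolynomial.idealOfVars (Fin n) K ≤ T)
    (u : Fin k → Fin n) (hu : Function.Injective u)
    (hX : ∀ j, (∃ i, u i = j) ∨ MvPolynomial.X j ∈ T)
    (q : Fin k → MvPolynomial (Fin n) K) (hq : ∀ i, q i ∈ T)
    (hq0 : ∀ i, MvPolynomial.constantCoeff (q i) = 0)
    (M : Matrix (Fin k) (Fin k) K)
    (hM : ∀ i j, M i j = MvPolynomial.eval (0 : Fin n → K) (MvPolynomial.pderiv (u j) (q i)))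
    (hdet : M.det ≠ 0) (j : Fin n) : MvPolynomial.X j ∈ T := by
  classical
  rcases hX j with ⟨l, rfl⟩ | h
  swap
  · exact h
  let v : Fin k → MvPolynomial (Fin n) K := fun i => MvPolynomial.X (u i)
  let M' := M.map (MvPolynomial.C (σ := Fin n))
  have h1 : ∀ i, (M'.mulVec v) i ∈ T := by
    intro i
    have h := hT (aux_linear (q i))
    rw [hq0, map_zero, sub_zero] at h
    have h2 := sub_mem (hq i) h
    rw [sub_sub_cancel, ← Finset.sum_add_sum_compl (Finset.univ.image u)] at h2
    have h3 := (Ideal.add_mem_iff_left T (Ideal.sum_mem T (fun j hj => ?_))).mp h2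
    · rw [Finset.sum_image (fun _ _ _ _ h => hu h)] at h3
      simpa [Matrix.mulVec, dotProduct, M', v, hM] using h3
    · refine Ideal.mul_mem_left _ _ ((hX j).resolve_left ?_)
      rintro ⟨i, rfl⟩
      simp at hj
  have h2 : (M⁻¹.map (MvPolynomial.C (σ := Fin n))).mulVec (M'.mulVec v) = v := by
    rw [Matrix.mulVec_mulVec, ← Matrix.map_mul, Matrix.nonsing_inv_mul _ (Ne.isUnit hdet),
      Matrix.map_one _ (map_zero _) (map_one _), Matrix.one_mulVec]
  have h3 := congrFun h2 l
  change _ = MvPolynomial.X (u l) at h3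
  rw [← h3]
  simp only [Matrix.mulVec, dotProduct] at h1 ⊢
  exact Ideal.sum_mem T fun i _ => Ideal.mul_mem_left _ _ (h1 i)

theorem aux_main {R A C : Type*} [CommRing R] [CommRing A] [CommRing C] [IsLocalRing A]
    [IsNoetherianRing A] (al : R →+* A) (P : Ideal R)
    (hmA : IsLocalRing.maximalIdeal A = P.map al) {r k : ℕ} (g : Fin r → R) (q : Fin k → R)
    (hNT : P ≤ (Ideal.span (Set.range g) ⊔ Ideal.span (Set.range q)) ⊔ P * P)
    (hNP : Ideal.span (Set.range g) ⊔ Ideal.span (Set.range q) ≤ P)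
    (f : A →+* C) (hf : Function.Surjective f) (hfq : ∀ i, f (al (q i)) = 0)
    (hC : ringKrullDim C = (r : WithBot ℕ∞)) :
    RingHom.ker f ≤ Ideal.span (Set.range fun i => al (q i)) := by
  have hJf : Ideal.span (Set.range fun i => al (q i)) ≤ RingHom.ker f := by
    rw [Ideal.span_le]
    rintro _ ⟨i, rfl⟩
    exact hfq _
  have hNmap : (Ideal.span (Set.range g) ⊔ Ideal.span (Set.range q)).map al =
      Ideal.span (Set.range fun i => al (g i)) ⊔ Ideal.span (Set.range fun i => al (q i)) := by
    rw [Ideal.map_sup, Ideal.map_span, Ideal.map_span, ← Set.range_comp, ← Set.range_comp]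
    rfl
  refine aux_key _ (fun i => al (g i)) ?_ f hf hJf hC
  rw [← hNmap]
  apply le_antisymm
  · refine Submodule.le_of_le_smul_of_le_jacobson_bot (I := IsLocalRing.maximalIdeal A)
      (IsNoetherian.noetherian _) ?_ ?_
    · rw [IsLocalRing.jacobson_eq_maximalIdeal _ bot_ne_top]
    · have := Ideal.map_mono (f := al) hNT
      rw [Ideal.map_sup (f := al) (I := _ ⊔ _), Ideal.map_mul, ← hmA] at this
      exact this
  · rw [hmA]
    exact Ideal.map_mono hNP

theorem aux_span {K : Type*} [Field K] {n k r : ℕ} (hrn : r ≤ n) (hk : n = r + k)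
    (u : Fin k → Fin n) (hu : ∀ i, (u i : ℕ) = r + i)
    (q : Fin k → MvPolynomial (Fin n) K)
    (hq0 : ∀ i, MvPolynomial.constantCoeff (q i) = 0)
    (M : Matrix (Fin k) (Fin k) K)
    (hM : ∀ i j, M i j = MvPolynomial.eval (0 : Fin n → K) (MvPolynomial.pderiv (u j) (q i)))
    (hdet : M.det ≠ 0) (P : Ideal (MvPolynomial (Fin n) K))
    (hP : P = MvPolynomial.idealOfVars (Fin n) K) :
    P ≤ (Ideal.span (Set.range fun j : Fin r => MvPolynomial.X (Fin.castLE hrn j)) ⊔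
      Ideal.span (Set.range q)) ⊔ P * P := by
  set T := (Ideal.span (Set.range fun j : Fin r => MvPolynomial.X (Fin.castLE hrn j)) ⊔
      Ideal.span (Set.range q)) ⊔ P * P with hT
  have h1 : Ideal.span (Set.range fun j : Fin r => MvPolynomial.X (Fin.castLE hrn j)) ≤ T :=
    le_sup_left.trans le_sup_left
  have h2 : Ideal.span (Set.range q) ≤ T := le_sup_right.trans le_sup_left
  have h3 : P * P ≤ T := le_sup_right
  clear_value T
  have : ∀ j, MvPolynomial.X j ∈ T := by
    refine aux_vars_mem T (hP ▸ h3) u ?_ ?_ q (fun i => h2 (Ideal.subset_span ⟨i, rfl⟩))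
      hq0 M hM hdet
    · intro a b hab
      have := congrArg Fin.val hab
      rw [hu, hu] at this
      exact Fin.ext (by omega)
    · intro j
      by_cases hj : (j : ℕ) < r
      · right
        exact h1 (Ideal.subset_span ⟨⟨j, hj⟩, rfl⟩)
      · left
        refine ⟨⟨j - r, by have := j.isLt; omega⟩, Fin.ext ?_⟩
        rw [hu]
        simp only
        omega
  rw [hP, Ideal.span_le]
  rintro _ ⟨j, rfl⟩
  exact this j

/-- If `I = (p₁,…,p_s) ⊆ (X)`, `V = Spec K[X]/I` is smooth of dimension `r` at the
origin, and the Jacobian determinant `det(∂p_i/∂X_j(0))`, `i,j = r+1,…,n`, is nonzero,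
then `p_{r+1},…,pₙ` generate the localization `I·K[X]_{(X₁,…,Xₙ)}`. -/
theorem jacobian_minor_generates_localized_ideal
    {K : Type*} [Field K] [CharZero K] {n s r : ℕ} (hrn : r ≤ n) (hns : n ≤ s)
    (p : Fin s → MvPolynomial (Fin n) K)
    (I : Ideal (MvPolynomial (Fin n) K)) (hI : I = Ideal.span (Set.range p))
    (hI0 : ∀ i, MvPolynomial.constantCoeff (p i) = 0)
    -- dimension r at the origin
    (mQ : Ideal (MvPolynomial (Fin n) K ⧸ I))
    (hmQ : mQ = Ideal.map (Ideal.Quotient.mk I) (Ideal.span (Set.range MvPolynomial.X)))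
    [mQ.IsPrime]
    (hdim : ringKrullDim (Localization.AtPrime mQ) = (r : WithBot ℕ∞))
    -- smoothness at the origin: the local ring at the origin is regular of dimension r
    (hsmooth : ∃ gens : Finset (Localization.AtPrime mQ), gens.card = r ∧
      Ideal.span (gens : Set (Localization.AtPrime mQ))
        = IsLocalRing.maximalIdeal (Localization.AtPrime mQ))
    -- the Jacobian minor
    (hJ : (Matrix.det fun i j : Fin (n - r) =>
      MvPolynomial.eval (0 : Fin n → K)
        (MvPolynomial.pderiv (⟨r + (j : ℕ), by have := j.isLt; omega⟩ : Fin n)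
          (p ⟨r + (i : ℕ), by have := i.isLt; omega⟩))) ≠ 0)
    -- the localization of K[X] at the maximal ideal (X₁,…,Xₙ)
    (PX : Ideal (MvPolynomial (Fin n) K))
    (hPX : PX = Ideal.span (Set.range MvPolynomial.X)) [PX.IsPrime] :
    Ideal.span (Set.range fun i : Fin (n - r) =>
        algebraMap (MvPolynomial (Fin n) K) (Localization.AtPrime PX)
          (p ⟨r + (i : ℕ), by have := i.isLt; omega⟩))
      = I.map (algebraMap (MvPolynomial (Fin n) K) (Localization.AtPrime PX)) := by
  have hPXv : PX = MvPolynomial.idealOfVars (Fin n) K := hPX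
  have hpP : ∀ i, p i ∈ PX := by
    intro i
    have := aux_sub_const_mem (p i)
    rwa [hI0, map_zero, sub_zero, ← hPXv] at this
  have hIP : I ≤ PX := by
    rw [hI, Ideal.span_le]
    rintro _ ⟨i, rfl⟩
    exact hpP i
  have hpI : ∀ i, p i ∈ I := fun i => hI ▸ Ideal.subset_span ⟨i, rfl⟩
  have hcomap : PX = mQ.comap (Ideal.Quotient.mk I) := by
    rw [hmQ, ← hPX, Ideal.comap_map_of_surjective _ Ideal.Quotient.mk_surjective,
      ← RingHom.ker_eq_comap_bot, Ideal.mk_ker, sup_eq_left.mpr hIP]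
  have hf : Function.Surjective
      (Localization.localRingHom PX mQ (Ideal.Quotient.mk I) hcomap) :=
    (RingHom.surjectiveOnStalks_of_surjective
      Ideal.Quotient.mk_surjective).localRingHom_surjective _ _ hcomap
  have hfp : ∀ i, Localization.localRingHom PX mQ (Ideal.Quotient.mk I) hcomap
      (algebraMap _ _ (p i)) = 0 := by
    intro i
    rw [Localization.localRingHom_to_map, Ideal.Quotient.eq_zero_iff_mem.mpr (hpI i), map_zero]
  have hnoeth : IsNoetherianRing (Localization.AtPrime PX) :=
    IsLocalization.isNoetherianRing PX.primeCompl _ inferInstance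
  have hNT := aux_span hrn (by omega)
    (fun j : Fin (n - r) => (⟨r + (j : ℕ), by have := j.isLt; omega⟩ : Fin n)) (fun _ => rfl)
    (fun i : Fin (n - r) => p ⟨r + (i : ℕ), by have := i.isLt; omega⟩) (fun _ => hI0 _) _
    (fun _ _ => rfl) hJ PX hPXv
  have hker := aux_main (C := Localization.AtPrime mQ) (algebraMap (MvPolynomial (Fin n) K) (Localization.AtPrime PX)) PX
    (Localization.AtPrime.map_eq_maximalIdeal).symm _ _ hNT (by
      refine sup_le ?_ ?_
      · rw [Ideal.span_le]
        rintro _ ⟨i, rfl⟩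
        rw [hPX]
        exact Ideal.subset_span ⟨_, rfl⟩
      · rw [Ideal.span_le]
        rintro _ ⟨i, rfl⟩
        exact hpP _)
    (Localization.localRingHom PX mQ (Ideal.Quotient.mk I) hcomap) hf (fun _ => hfp _) hdim
  apply le_antisymm
  · rw [Ideal.span_le]
    rintro _ ⟨i, rfl⟩
    exact Ideal.mem_map_of_mem _ (hpI _)
  · have h2 : ∀ x ∈ I, algebraMap _ (Localization.AtPrime PX) x ∈ RingHom.ker
        (Localization.localRingHom PX mQ (Ideal.Quotient.mk I) hcomap) := by
      intro x hx
      rw [RingHom.mem_ker, Localization.localRingHom_to_map,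
        Ideal.Quotient.eq_zero_iff_mem.mpr hx, map_zero]
    exact (Ideal.map_le_iff_le_comap.mpr h2).trans hker
end
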